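/- Existence for β<0, radially symmetric V (Theorem 1.1, part (2)). Let β<0 and let V : ℝ² → ℝ be nonnegative, locally integrable and radially symmetric, with constants C>0 and 0<R₁<R₂ such that V(x) ≥ C for a.e. x with R₁<‖x‖<R₂. Assume that for every α < -β one has ∫_{‖x‖≥1} V(x)·‖x‖^{2α} dx < ∞ (this encodes β ≥ -α(V), where α(V) is the supremum of exponents α with ∫_{‖x‖≥1}|V|·‖x‖^{2α} < ∞). Then there exists a locally integrable, radially symmetric ψ : ℝ² → ℝ, continuously differentiable on ℝ²∖{0} and with ∫_{D(0,R)∖{0}} ‖∇ψ‖² dx < ∞ for every R>0, such that ψ is a weak solution of -Δψ = 4πβ·V·e^{ψ} on ℝ², ∫_{ℝ²} V·e^{ψ} dx = 1, and ψ(x)/log‖x‖ → -2β as ‖x‖ → ∞. -/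

import Mathlib

open MeasureTheory Real Filter Bornology Metric
open scoped NNReal

noncomputable section

abbrev R2 : Type := EuclideanSpace ℝ (Fin 2)

/-- The Laplacian of `f : ℝ² → ℝ`, via the second iterated Fréchet derivative. -/
def lap (f : R2 → ℝ) (x : R2) : ℝ :=
  ∑ i : Fin 2, iteratedFDeriv ℝ 2 f x ![EuclideanSpace.single i 1, EuclideanSpace.single i 1]

/-- `ψ` is a weak (distributional) solution of `-Δψ = g` on `ℝ²`:
for every smooth compactly supported test function `φ`, `∫ ψ·Δφ = -∫ g·φ`. -/
def IsWeakSol (ψ g : R2 → ℝ) : Prop :=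
  ∀ φ : R2 → ℝ, ContDiff ℝ (⊤ : ℕ∞) φ → HasCompactSupport φ →
    ∫ x : R2, ψ x * lap φ x = -∫ x : R2, g x * φ x

/-- `f` is radially symmetric. -/
def RadSym (f : R2 → ℝ) : Prop := ∀ x y : R2, ‖x‖ = ‖y‖ → f x = f y


/-- Values at the nodes `t j` of the solution of the discrete Volterra equation started at
`log x`. -/
def nodeVal (b : ℝ) (t k : ℕ → ℝ) (x : ℝ) : ℕ → ℝ
  | j => x * Real.exp (b * ∑ i : Fin j, (t j - t i) * (k i * nodeVal b t k x i))
  decreasing_by exact i.2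

lemma nodeVal_eq (b : ℝ) (t k : ℕ → ℝ) (x : ℝ) (j : ℕ) :
    nodeVal b t k x j =
      x * Real.exp (b * ∑ i ∈ Finset.range j, (t j - t i) * (k i * nodeVal b t k x i)) := by
  rw [nodeVal, Finset.sum_range fun i => (t j - t i) * (k i * nodeVal b t k x i)]

lemma continuous_nodeVal (b : ℝ) (t k : ℕ → ℝ) (j : ℕ) :
    Continuous fun x => nodeVal b t k x j := by
  induction j using Nat.strong_induction_on with
  | _ j ih =>
    simp_rw [nodeVal_eq b t k _ j]
    refine continuous_id.mul (Real.continuous_exp.comp (continuous_const.mul ?_))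
    refine continuous_finsetSum _ fun i hi => ?_
    exact continuous_const.mul (continuous_const.mul (ih i (Finset.mem_range.1 hi)))

lemma nodeVal_nonneg (b : ℝ) (t k : ℕ → ℝ) {x : ℝ} (hx : 0 ≤ x) (j : ℕ) :
    0 ≤ nodeVal b t k x j := by
  rw [nodeVal_eq]; positivity

lemma le_nodeVal {b : ℝ} (hb : 0 ≤ b) {t k : ℕ → ℝ} (ht : Monotone t) (hk : ∀ i, 0 ≤ k i)
    {x : ℝ} (hx : 0 ≤ x) (j : ℕ) : x ≤ nodeVal b t k x j := by
  rw [nodeVal_eq]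
  refine le_mul_of_one_le_right hx (Real.one_le_exp ?_)
  refine mul_nonneg hb (Finset.sum_nonneg fun i hi => ?_)
  exact mul_nonneg (sub_nonneg.2 (ht (Finset.mem_range.1 hi).le))
    (mul_nonneg (hk i) (nodeVal_nonneg b t k hx i))

/-- The discrete equation has a solution of total mass one. -/
lemma exists_discrete_solution {b : ℝ} (hb : 0 ≤ b) {t k : ℕ → ℝ} (ht : Monotone t)
    (hk : ∀ i, 0 ≤ k i) (N : ℕ) (hN : 0 < ∑ i ∈ Finset.range N, k i) :
    ∃ (a : ℝ) (u : ℝ → ℝ),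
      (∀ τ, u τ = a + b * ∑ i ∈ Finset.range N, max (τ - t i) 0 * (k i * Real.exp (u (t i)))) ∧
      ∑ i ∈ Finset.range N, k i * Real.exp (u (t i)) = 1 := by
  set S := ∑ i ∈ Finset.range N, k i
  have hcont : Continuous fun x => ∑ i ∈ Finset.range N, k i * nodeVal b t k x i :=
    continuous_finsetSum _ fun i _ => continuous_const.mul (continuous_nodeVal b t k i)
  have h0 : ∑ i ∈ Finset.range N, k i * nodeVal b t k 0 i = 0 :=
    Finset.sum_eq_zero fun i _ => by rw [nodeVal_eq]; simp
  have h1 : 1 ≤ ∑ i ∈ Finset.range N, k i * nodeVal b t k S⁻¹ i := by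
    calc (1 : ℝ) = ∑ i ∈ Finset.range N, k i * S⁻¹ := by
          rw [← Finset.sum_mul, mul_inv_cancel₀ hN.ne']
      _ ≤ _ := Finset.sum_le_sum fun i _ =>
          mul_le_mul_of_nonneg_left (le_nodeVal hb ht hk (inv_nonneg.2 hN.le) i) (hk i)
  obtain ⟨x, hx, hx1⟩ := intermediate_value_Icc (inv_nonneg.2 hN.le) hcont.continuousOn
    (show (1 : ℝ) ∈ Set.Icc _ _ from ⟨by simp only [h0]; norm_num, h1⟩)
  have hxpos : 0 < x := by
    refine lt_of_le_of_ne hx.1 fun h => ?_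
    simp only [← h, h0] at hx1
    norm_num at hx1
  let u : ℝ → ℝ := fun τ =>
    Real.log x + b * ∑ i ∈ Finset.range N, max (τ - t i) 0 * (k i * nodeVal b t k x i)
  have hu : ∀ j ∈ Finset.range N, Real.exp (u (t j)) = nodeVal b t k x j := by
    intro j hj
    simp only [u]
    rw [nodeVal_eq b t k x j, Real.exp_add, Real.exp_log hxpos]
    congr 3
    rw [← Finset.sum_subset (Finset.range_mono (Finset.mem_range.1 hj).le)]
    · refine Finset.sum_congr rfl fun i hi => ?_
      rw [max_eq_left (sub_nonneg.2 (ht (Finset.mem_range.1 hi).le))]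
    · intro i _ hi
      rw [max_eq_right (sub_nonpos.2 (ht (by simpa using hi))), zero_mul]
  refine ⟨Real.log x, u, fun τ => ?_, ?_⟩
  · simp only [u]
    congr 2
    exact Finset.sum_congr rfl fun i hi => by rw [← hu i hi]
  · rw [← hx1]
    exact Finset.sum_congr rfl fun i hi => by rw [hu i hi]

/-- The grid of mesh `1 / n` starting at `-n`. -/
def gridPt (n i : ℕ) : ℝ := -n + i / n

/-- The grid index of the cell containing `s`. -/
def gridIdx (n : ℕ) (s : ℝ) : ℕ := ⌊(s + n) * n⌋₊

/-- Rounding to the grid. -/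
def quant (n : ℕ) (s : ℝ) : ℝ := gridPt n (gridIdx n s)

lemma gridPt_mono (n : ℕ) : Monotone (gridPt n) := fun i j hij => by
  unfold gridPt; gcongr

lemma measurable_gridIdx (n : ℕ) : Measurable (gridIdx n) :=
  Nat.measurable_floor.comp (by fun_prop)

lemma measurable_quant (n : ℕ) : Measurable (quant n) :=
  (measurable_from_nat (f := gridPt n)).comp (measurable_gridIdx n)

lemma quant_le {n : ℕ} (hn : 0 < n) {s : ℝ} (hs : -(n : ℝ) ≤ s) : quant n s ≤ s := by
  have hn' : (0 : ℝ) < n := by exact_mod_cast hn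
  have := Nat.floor_le (a := (s + n) * n) (mul_nonneg (by linarith) hn'.le)
  unfold quant gridPt gridIdx
  have h2 : (⌊(s + n) * n⌋₊ : ℝ) / n ≤ s + n := by rwa [div_le_iff₀ hn']
  linarith

lemma lt_quant {n : ℕ} (hn : 0 < n) (s : ℝ) : s - 1 / n < quant n s := by
  have hn' : (0 : ℝ) < n := by exact_mod_cast hn
  have := Nat.lt_floor_add_one ((s + n) * n)
  unfold quant gridPt gridIdx
  have h2 : s + n < ((⌊(s + n) * n⌋₊ : ℝ) + 1) / n := by rwa [lt_div_iff₀ hn']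
  rw [add_div] at h2
  linarith

lemma quant_le_max {n : ℕ} (hn : 0 < n) (s : ℝ) : quant n s ≤ max s (-n) := by
  rcases le_total (-(n : ℝ)) s with h | h
  · exact (quant_le hn h).trans (le_max_left _ _)
  · have : gridIdx n s = 0 := by
      unfold gridIdx
      exact Nat.floor_of_nonpos (mul_nonpos_of_nonpos_of_nonneg (by linarith) (by positivity))
    simp [quant, gridPt, this]

lemma quant_nonneg {n : ℕ} (hn : 0 < n) {s : ℝ} (hs : 1 ≤ s) : 0 ≤ quant n s := by
  have := lt_quant hn s
  have h1 : (1 : ℝ) / n ≤ 1 := by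
    rw [div_le_one (by exact_mod_cast hn)]; exact_mod_cast hn
  linarith

lemma tendsto_quant (s : ℝ) : Tendsto (fun n => quant n s) atTop (nhds s) := by
  have h1 : Tendsto (fun n : ℕ => s - 1 / (n : ℝ)) atTop (nhds s) := by
    simpa using tendsto_const_nhds.sub (tendsto_one_div_atTop_nhds_zero_nat (𝕜 := ℝ))
  refine tendsto_of_tendsto_of_tendsto_of_le_of_le' h1 tendsto_const_nhds ?_ ?_
  · filter_upwards [eventually_gt_atTop 0] with n hn using (lt_quant hn s).le
  · filter_upwards [eventually_gt_atTop 0, eventually_ge_atTop ⌈-s⌉₊] with n hn hn2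
    refine quant_le hn ?_
    have := Nat.ceil_le.1 hn2
    linarith

lemma gridIdx_lt_iff {n : ℕ} (hn : 0 < n) (s : ℝ) : gridIdx n s < 2 * n ^ 2 ↔ s < n := by
  have hn' : (0 : ℝ) < n := by exact_mod_cast hn
  unfold gridIdx
  rw [Nat.floor_lt' (by positivity)]
  push_cast
  rw [show (2 : ℝ) * n ^ 2 = (n + n) * n by ring, mul_lt_mul_iff_left₀ hn', add_lt_add_iff_right]

lemma sum_eq_setIntegral {ν : Measure ℝ} {J : ℝ → ℕ} (hJ : Measurable J) (N : ℕ)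
    (hfin : ν {s | J s < N} < ⊤) (w : ℕ → ℝ) :
    IntegrableOn (fun s => w (J s)) {s | J s < N} ν ∧
    ∑ i ∈ Finset.range N, ν.real (J ⁻¹' {i}) * w i = ∫ s in {s | J s < N}, w (J s) ∂ν := by
  have hset : {s | J s < N} = ⋃ i ∈ Finset.range N, J ⁻¹' {i} := by
    ext s; simp
  have hm : ∀ i, MeasurableSet (J ⁻¹' {i}) := fun i => hJ (measurableSet_singleton i)
  have hlt : ∀ i ∈ Finset.range N, ν (J ⁻¹' {i}) < ⊤ := fun i hi =>
    (measure_mono (by intro s hs; simp at hs hi ⊢; omega)).trans_lt hfin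
  have hint : ∀ i ∈ Finset.range N, IntegrableOn (fun s => w (J s)) (J ⁻¹' {i}) ν := by
    intro i hi
    refine (integrableOn_const (C := w i) (hlt i hi).ne).congr_fun ?_ (hm i)
    intro s hs
    simp at hs
    simp [hs]
  refine ⟨by rw [hset]; exact integrableOn_finset_iUnion.2 hint, ?_⟩
  rw [hset, integral_biUnion_finset _ (fun i _ => hm i) ?_ hint]
  · refine Finset.sum_congr rfl fun i hi => ?_
    rw [setIntegral_congr_fun (hm i) (g := fun _ => w i) (fun s hs => by simp at hs; simp [hs])]
    simp
  · intro i _ j _ hij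
    exact Disjoint.preimage _ (by simpa using hij)

/-- Solution of the equation with quantized nodes and truncated measure. -/
lemma exists_quant_solution {b : ℝ} (hb : 0 ≤ b) {ν : Measure ℝ} (hfin : ∀ R, ν (Set.Iic R) < ⊤)
    {n : ℕ} (hn : 0 < n) (hpos : ν (Set.Iio n) ≠ 0) :
    ∃ u : ℝ → ℝ,
      IntegrableOn (fun s => Real.exp (u (quant n s))) (Set.Iio n) ν ∧
      ∫ s in Set.Iio (n : ℝ), Real.exp (u (quant n s)) ∂ν = 1 ∧
      ∀ τ, u τ = u 0 + b * ∫ s in Set.Iio (n : ℝ),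
        (max τ (quant n s) - max 0 (quant n s)) * Real.exp (u (quant n s)) ∂ν := by
  have hset : {s | gridIdx n s < 2 * n ^ 2} = Set.Iio (n : ℝ) := by
    ext s; exact gridIdx_lt_iff hn s
  have hfin' : ν {s | gridIdx n s < 2 * n ^ 2} < ⊤ := by
    rw [hset]; exact (measure_mono Set.Iio_subset_Iic_self).trans_lt (hfin n)
  have key := fun w => sum_eq_setIntegral (measurable_gridIdx n) (2 * n ^ 2) hfin' w
  simp_rw [hset] at key hfin'
  obtain ⟨a, u, hu, hu1⟩ := exists_discrete_solution hb (gridPt_mono n)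
    (k := fun i => ν.real (gridIdx n ⁻¹' {i})) (fun i => measureReal_nonneg) (2 * n ^ 2) (by
      have := (key fun _ => 1).2
      simp only [mul_one, integral_const, smul_eq_mul, measureReal_restrict_apply_univ] at this
      rw [this]
      exact ENNReal.toReal_pos hpos hfin'.ne)
  have hu1' := (key fun i => Real.exp (u (gridPt n i)))
  refine ⟨u, hu1'.1, hu1'.2.symm.trans hu1, fun τ => ?_⟩
  have hK : ∀ τ, ∑ i ∈ Finset.range (2 * n ^ 2), max (τ - gridPt n i) 0 *
      (ν.real (gridIdx n ⁻¹' {i}) * Real.exp (u (gridPt n i))) =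
      ∫ s in Set.Iio (n : ℝ), max (τ - quant n s) 0 * Real.exp (u (quant n s)) ∂ν := by
    intro τ
    refine Eq.trans ?_ (key fun i => max (τ - gridPt n i) 0 * Real.exp (u (gridPt n i))).2
    exact Finset.sum_congr rfl fun i _ => by ring
  have hI : ∀ τ, IntegrableOn (fun s => max (τ - quant n s) 0 * Real.exp (u (quant n s)))
      (Set.Iio (n : ℝ)) ν := fun τ =>
    (key fun i => max (τ - gridPt n i) 0 * Real.exp (u (gridPt n i))).1
  rw [hu τ, hu 0, hK, hK, add_assoc, ← mul_add, add_right_inj]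
  congr 1
  rw [← sub_eq_iff_eq_add', ← integral_sub (hI τ) (hI 0)]
  refine integral_congr_ae (Eventually.of_forall fun s => ?_)
  simp only
  rw [← sub_mul]
  congr 1
  rcases le_total τ (quant n s) with h1 | h1 <;> rcases le_total 0 (quant n s) with h2 | h2 <;>
    simp [h1, h2]

/-- The density `exp u` at the grid points, cut off at `n`. -/
def quantWeight (n : ℕ) (u : ℝ → ℝ) : ℝ → ℝ :=
  (Set.Iio (n : ℝ)).indicator fun s => Real.exp (u (quant n s))

lemma quantWeight_nonneg (n : ℕ) (u : ℝ → ℝ) (s : ℝ) : 0 ≤ quantWeight n u s :=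
  Set.indicator_nonneg (fun _ _ => (Real.exp_pos _).le) s

lemma quantWeight_le (n : ℕ) (u : ℝ → ℝ) (s : ℝ) :
    quantWeight n u s ≤ Real.exp (u (quant n s)) :=
  Set.indicator_le_self' (fun _ _ => (Real.exp_pos _).le) s

/-- `u` solves the integrated radial equation with quantized nodes. -/
structure IsQuantSol (b : ℝ) (ν : Measure ℝ) (n : ℕ) (u : ℝ → ℝ) : Prop where
  integrable : Integrable (quantWeight n u) ν
  integral_eq : ∫ s, quantWeight n u s ∂ν = 1
  eq : ∀ τ, u τ = u 0 + b * ∫ s, (max τ (quant n s) - max 0 (quant n s)) * quantWeight n u s ∂ν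

lemma exists_isQuantSol {b : ℝ} (hb : 0 ≤ b) {ν : Measure ℝ} (hfin : ∀ R, ν (Set.Iic R) < ⊤)
    {n : ℕ} (hn : 0 < n) (hpos : ν (Set.Iio n) ≠ 0) : ∃ u, IsQuantSol b ν n u := by
  obtain ⟨u, h1, h2, h3⟩ := exists_quant_solution hb hfin hn hpos
  refine ⟨u, (integrable_indicator_iff measurableSet_Iio).2 h1, ?_, fun τ => ?_⟩
  · rw [← h2, ← integral_indicator measurableSet_Iio]; rfl
  · rw [h3 τ, ← integral_indicator measurableSet_Iio]
    congr 2
    refine integral_congr_ae (Eventually.of_forall fun s => ?_)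
    simp only [quantWeight, Set.indicator_apply]
    split_ifs <;> simp

lemma abs_kernel_le (τ τ' q : ℝ) : |max τ q - max τ' q| ≤ |τ - τ'| :=
  abs_max_sub_max_le_abs τ τ' q

namespace IsQuantSol

variable {b : ℝ} {ν : Measure ℝ} {n : ℕ} {u : ℝ → ℝ}

lemma integrable_kernel (h : IsQuantSol b ν n u) (τ τ' : ℝ) :
    Integrable (fun s => (max τ (quant n s) - max τ' (quant n s)) * quantWeight n u s) ν := by
  refine h.integrable.bdd_mul (c := |τ - τ'|) ?_ (Eventually.of_forall fun s => ?_)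
  · have := measurable_quant n
    exact Measurable.aestronglyMeasurable (by fun_prop)
  · exact abs_kernel_le _ _ _

lemma sub_eq (h : IsQuantSol b ν n u) (τ τ' : ℝ) :
    u τ - u τ' = b * ∫ s, (max τ (quant n s) - max τ' (quant n s)) * quantWeight n u s ∂ν := by
  rw [h.eq τ, h.eq τ', add_sub_add_left_eq_sub, ← mul_sub,
    ← integral_sub (h.integrable_kernel _ _) (h.integrable_kernel _ _)]
  congr 2
  ext s
  ring

lemma integral_kernel_le (h : IsQuantSol b ν n u) {τ τ' c : ℝ}
    (hc : ∀ q, max τ q - max τ' q ≤ c) :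
    ∫ s, (max τ (quant n s) - max τ' (quant n s)) * quantWeight n u s ∂ν ≤ c := by
  calc _ ≤ ∫ s, c * quantWeight n u s ∂ν :=
        integral_mono (h.integrable_kernel _ _) (h.integrable.const_mul c) fun s =>
          mul_le_mul_of_nonneg_right (hc _) (quantWeight_nonneg n u s)
    _ = c := by rw [integral_const_mul, h.integral_eq, mul_one]

lemma abs_sub_le (h : IsQuantSol b ν n u) (hb : 0 ≤ b) (τ τ' : ℝ) :
    |u τ - u τ'| ≤ b * |τ - τ'| := by
  rw [abs_le', neg_sub]
  constructor
  · rw [h.sub_eq]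
    exact mul_le_mul_of_nonneg_left
      (h.integral_kernel_le fun q => (le_abs_self _).trans (abs_kernel_le _ _ _)) hb
  · rw [h.sub_eq, abs_sub_comm]
    exact mul_le_mul_of_nonneg_left
      (h.integral_kernel_le fun q => (le_abs_self _).trans (abs_kernel_le _ _ _)) hb

lemma le_add (h : IsQuantSol b ν n u) (hb : 0 ≤ b) (τ : ℝ) : u τ ≤ u 0 + b * max τ 0 := by
  have : u τ - u 0 ≤ b * max τ 0 := by
    rw [h.sub_eq]
    refine mul_le_mul_of_nonneg_left (h.integral_kernel_le fun q => ?_) hb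
    rcases le_total τ q with h1 | h1 <;> rcases le_total 0 q with h2 | h2 <;>
      rcases le_total τ 0 with h3 | h3 <;> simp [h1, h2, h3] <;> linarith
  linarith

/-- Slope bound by the mass on the left. -/
lemma le_add_mass (h : IsQuantSol b ν n u) (hb : 0 ≤ b) {τ : ℝ} (hτ : 0 ≤ τ) :
    u τ ≤ u 0 + b * (τ * ∫ s in {s | quant n s < τ}, quantWeight n u s ∂ν) := by
  have hm : MeasurableSet {s | quant n s < τ} :=
    measurableSet_lt (measurable_quant n) measurable_const
  rw [h.eq τ, ← integral_const_mul τ, ← integral_indicator hm]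
  gcongr
  · exact h.integrable_kernel _ _
  · exact (h.integrable.const_mul τ).indicator hm
  · intro s
    have hw := quantWeight_nonneg n u s
    beta_reduce
    by_cases hs : quant n s < τ
    · rw [Set.indicator_of_mem (by exact hs)]
      refine mul_le_mul_of_nonneg_right ?_ hw
      have := le_max_left 0 (quant n s)
      have := le_max_right 0 (quant n s)
      rw [max_eq_left hs.le]; linarith
    · rw [Set.indicator_of_notMem (by exact hs)]
      rw [max_eq_right (not_lt.1 hs), max_eq_right (hτ.trans (not_lt.1 hs))]; simp

/-- Mass cannot sit beyond the point where almost all of it has been collected. -/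
lemma exists_mass_cutoff (h : IsQuantSol b ν n u) {δ : ℝ} (hδ : 0 ≤ δ) :
    ∃ U : Set ℝ, MeasurableSet U ∧ ∫ s in U, quantWeight n u s ∂ν ≤ δ ∧
      ∀ s ∉ U, ∫ r in {r | quant n r < quant n s}, quantWeight n u r ∂ν ≤ 1 - δ := by
  set G : ℝ → ℝ := fun τ => ∫ r in {r | quant n r < τ}, quantWeight n u r ∂ν with hG
  have hm : ∀ τ, MeasurableSet {s | quant n s < τ} := fun τ =>
    measurableSet_lt (measurable_quant n) measurable_const
  by_cases hne : ∃ i, ∃ s, gridIdx n s = i ∧ 1 - δ < G (quant n s)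
  · classical
    obtain ⟨s₀, hs₀, hs₀'⟩ := Nat.find_spec hne
    refine ⟨{r | quant n r < quant n s₀}ᶜ, (hm _).compl, ?_, ?_⟩
    · have := integral_add_compl (hm (quant n s₀)) h.integrable
      rw [h.integral_eq] at this
      simp only [hG] at hs₀'
      linarith
    · intro s hs
      simp only [Set.mem_compl_iff, not_not, Set.mem_ofPred_eq] at hs
      by_contra hcon
      have h1 : Nat.find hne ≤ gridIdx n s := Nat.find_min' hne ⟨s, rfl, not_le.1 hcon⟩
      rw [← hs₀] at h1
      exact absurd (gridPt_mono n h1) (not_le.2 hs)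
  · push Not at hne
    exact ⟨∅, MeasurableSet.empty, by simpa using hδ, fun s _ => hne _ s rfl⟩

/-- Uniform tail bound. -/
lemma tail_le (h : IsQuantSol b ν n u) (hb : 0 ≤ b) (hn : 0 < n) {A δ R : ℝ}
    (hA : Real.exp (u 0) ≤ A) (hδ : 0 ≤ δ) (hR : 1 ≤ R)
    (hint : IntegrableOn (fun s => Real.exp (b * (1 - δ) * s)) (Set.Ici R) ν) :
    ∫ s in Set.Ici R, quantWeight n u s ∂ν ≤
      δ + A * ∫ s in Set.Ici R, Real.exp (b * (1 - δ) * s) ∂ν := by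
  obtain ⟨U, hU, hUm, hUc⟩ := h.exists_mass_cutoff hδ
  have hA0 : 0 ≤ A := (Real.exp_pos _).le.trans hA
  calc ∫ s in Set.Ici R, quantWeight n u s ∂ν
      ≤ ∫ s in Set.Ici R, (U.indicator (quantWeight n u) s + A * Real.exp (b * (1 - δ) * s)) ∂ν := by
        refine setIntegral_mono_on h.integrable.integrableOn
          ((h.integrable.indicator hU).integrableOn.add (hint.const_mul A)) measurableSet_Ici ?_
        intro s hs
        by_cases hsU : s ∈ U
        · rw [Set.indicator_of_mem hsU]
          have : 0 ≤ A * Real.exp (b * (1 - δ) * s) := by positivity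
          linarith
        · rw [Set.indicator_of_notMem hsU, zero_add]
          have hs1 : (1 : ℝ) ≤ s := hR.trans hs
          have hq0 := quant_nonneg hn hs1
          have hqs : quant n s ≤ s := quant_le hn (by linarith [Nat.cast_nonneg (α := ℝ) n])
          have hc := hUc s hsU
          have hm0 : 0 ≤ ∫ r in {r | quant n r < quant n s}, quantWeight n u r ∂ν :=
            integral_nonneg fun r => quantWeight_nonneg n u r
          calc quantWeight n u s ≤ Real.exp (u (quant n s)) := quantWeight_le n u s
            _ ≤ Real.exp (u 0 + b * (1 - δ) * s) := by
                refine Real.exp_le_exp.2 ((h.le_add_mass hb hq0).trans ?_)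
                rw [mul_assoc, mul_comm (1 - δ)]
                gcongr
            _ ≤ _ := by rw [Real.exp_add]; gcongr
    _ = ∫ s in Set.Ici R, U.indicator (quantWeight n u) s ∂ν +
          A * ∫ s in Set.Ici R, Real.exp (b * (1 - δ) * s) ∂ν := by
        rw [integral_add (h.integrable.indicator hU).integrableOn (hint.const_mul A),
          integral_const_mul]
    _ ≤ _ := by
        gcongr
        refine (setIntegral_le_integral (h.integrable.indicator hU) (Eventually.of_forall
          fun s => Set.indicator_nonneg (fun _ _ => quantWeight_nonneg n u _) s)).trans ?_
        rwa [integral_indicator hU]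

end IsQuantSol

/-- Equi-Lipschitz functions bounded at one point have a pointwise convergent subsequence. -/
lemma exists_subseq_tendsto_of_lipschitz {b B : ℝ} (hb : 0 ≤ b) {w : ℕ → ℝ → ℝ}
    (hw : ∀ k τ τ', |w k τ - w k τ'| ≤ b * |τ - τ'|) (hw0 : ∀ k, |w k 0| ≤ B) :
    ∃ (φ : ℕ → ℕ) (u : ℝ → ℝ), StrictMono φ ∧
      ∀ τ, Tendsto (fun k => w (φ k) τ) atTop (nhds (u τ)) := by
  let b' : ℝ≥0 := ⟨b, hb⟩
  have hlip : ∀ k, LipschitzWith b' (w k) := fun k =>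
    LipschitzWith.of_dist_le_mul fun x y => by
      rw [Real.dist_eq, Real.dist_eq]; exact hw k x y
  let S : Set C(ℝ, ℝ) := {f | LipschitzWith b' f ∧ |f 0| ≤ B}
  have hS1 : IsCompact (ContinuousMap.toFun '' S) := by
    have himg : ContinuousMap.toFun '' S = {f | LipschitzWith b' f} ∩ {f : ℝ → ℝ | |f 0| ≤ B} := by
      ext f
      constructor
      · rintro ⟨g, hg, rfl⟩; exact hg
      · rintro ⟨h1, h2⟩; exact ⟨⟨f, h1.continuous⟩, ⟨h1, h2⟩, rfl⟩
    have hcl : IsClosed (ContinuousMap.toFun '' S) := by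
      rw [himg]
      refine (isClosed_setOfPred_lipschitzWith b').inter ?_
      exact isClosed_le (by fun_prop) continuous_const
    refine (isCompact_univ_pi fun τ : ℝ =>
      isCompact_Icc (a := -(B + b * |τ|)) (b := B + b * |τ|)).of_isClosed_subset hcl ?_
    rw [himg]
    rintro f ⟨h1, h2⟩ τ -
    have h3 : |f τ - f 0| ≤ b * |τ| := by
      have := h1.dist_le_mul τ 0
      rw [Real.dist_eq, Real.dist_eq, sub_zero] at this
      exact this
    rw [abs_le] at h3
    have h4 : |f 0| ≤ B := h2
    rw [abs_le] at h4
    constructor <;> linarith [h3.1, h3.2, h4.1, h4.2]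
  have hS2 : Equicontinuous ((↑) : S → ℝ → ℝ) :=
    (LipschitzWith.uniformEquicontinuous _ b' fun f => f.2.1).equicontinuous
  have hS := ArzelaAscoli.isCompact_of_equicontinuous S hS1 hS2
  obtain ⟨g, -, φ, hφ, hlim⟩ := hS.tendsto_subseq
    (x := fun k => (⟨w k, (hlip k).continuous⟩ : C(ℝ, ℝ))) fun k => ⟨hlip k, hw0 k⟩
  exact ⟨φ, g, hφ, fun τ => ((continuous_eval_const τ).tendsto g).comp hlim⟩

/-- Passing to the limit under an integral for a uniformly tight sequence of densities. -/
lemma integrable_and_tendsto_of_tight {ν : Measure ℝ} (hfin : ∀ R, ν (Set.Iic R) < ⊤)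
    {f : ℕ → ℝ → ℝ} {g : ℝ → ℝ} (hf0 : ∀ k s, 0 ≤ f k s) (hfi : ∀ k, Integrable (f k) ν)
    (hf1 : ∀ k, ∫ s, f k s ∂ν = 1)
    (hlim : ∀ s, Tendsto (fun k => f k s) atTop (nhds (g s)))
    (hbd : ∀ R, ∃ D, ∀ k, ∀ s < R, f k s ≤ D)
    (htail : ∀ ε > 0, ∃ R, ∀ k, ∫ s in Set.Ici R, f k s ∂ν ≤ ε) :
    Integrable g ν ∧ ∀ (M : ℝ) (κ : ℕ → ℝ → ℝ) (κ' : ℝ → ℝ),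
      (∀ k, AEStronglyMeasurable (κ k) ν) → (∀ k s, |κ k s| ≤ M) →
      (∀ s, Tendsto (fun k => κ k s) atTop (nhds (κ' s))) →
      Tendsto (fun k => ∫ s, κ k s * f k s ∂ν) atTop (nhds (∫ s, κ' s * g s ∂ν)) := by
  have hg0 : ∀ s, 0 ≤ g s := fun s => ge_of_tendsto' (hlim s) fun k => hf0 k s
  have hgm : AEStronglyMeasurable g ν :=
    aestronglyMeasurable_of_tendsto_ae atTop (fun k => (hfi k).1) (Eventually.of_forall hlim)
  have fatou : ∀ (S : Set ℝ) (c : ℝ), (∀ k, ∫ s in S, f k s ∂ν ≤ c) →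
      ∫⁻ s in S, ENNReal.ofReal (g s) ∂ν ≤ ENNReal.ofReal c := by
    intro S c hc
    calc ∫⁻ s in S, ENNReal.ofReal (g s) ∂ν
        = ∫⁻ s in S, liminf (fun k => ENNReal.ofReal (f k s)) atTop ∂ν := by
          refine lintegral_congr fun s => ?_
          exact ((ENNReal.continuous_ofReal.tendsto _).comp (hlim s)).liminf_eq.symm
      _ ≤ liminf (fun k => ∫⁻ s in S, ENNReal.ofReal (f k s) ∂ν) atTop :=
          lintegral_liminf_le' fun k => (hfi k).1.aemeasurable.restrict.ennreal_ofReal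
      _ ≤ ENNReal.ofReal c := by
          refine liminf_le_of_le (by isBoundedDefault) fun a ha => ?_
          obtain ⟨k, hk⟩ := ha.exists
          refine hk.trans ?_
          rw [← ofReal_integral_eq_lintegral_ofReal (hfi k).integrableOn
            (Eventually.of_forall (hf0 k))]
          exact ENNReal.ofReal_le_ofReal (hc k)
  have hg : Integrable g ν := by
    refine ⟨hgm, ?_⟩
    rw [hasFiniteIntegral_iff_ofReal (Eventually.of_forall hg0)]
    have := fatou Set.univ 1 fun k => by rw [setIntegral_univ, hf1]
    rw [Measure.restrict_univ] at this
    exact this.trans_lt ENNReal.ofReal_lt_top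
  refine ⟨hg, fun M κ κ' hκm hκM hκ => ?_⟩
  have hM : 0 ≤ M := (abs_nonneg _).trans (hκM 0 0)
  have hκ'M : ∀ s, |κ' s| ≤ M := fun s => le_of_tendsto' (hκ s).abs fun k => hκM k s
  have hκ'm : AEStronglyMeasurable κ' ν :=
    aestronglyMeasurable_of_tendsto_ae atTop hκm (Eventually.of_forall hκ)
  have hi : ∀ k, Integrable (fun s => κ k s * f k s) ν := fun k =>
    (hfi k).bdd_mul (hκm k) (Eventually.of_forall (hκM k))
  have hi' : Integrable (fun s => κ' s * g s) ν := hg.bdd_mul hκ'm (Eventually.of_forall hκ'M)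
  rw [Metric.tendsto_atTop]
  intro ε hε
  obtain ⟨R, hR⟩ := htail (ε / (4 * (M + 1))) (by positivity)
  have hRg : ∫ s in Set.Ici R, g s ∂ν ≤ ε / (4 * (M + 1)) := by
    have := fatou (Set.Ici R) _ hR
    rw [← ofReal_integral_eq_lintegral_ofReal hg.integrableOn (Eventually.of_forall hg0)] at this
    exact (ENNReal.ofReal_le_ofReal_iff (by positivity)).1 this
  have tailbd : ∀ (p q : ℝ → ℝ), (∀ s, |p s| ≤ M) → (∀ s, 0 ≤ q s) → Integrable q ν →
      ∫ s in Set.Ici R, q s ∂ν ≤ ε / (4 * (M + 1)) →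
      |∫ s in Set.Ici R, p s * q s ∂ν| ≤ ε / 4 := by
    intro p q hp hq hqi hqR
    calc |∫ s in Set.Ici R, p s * q s ∂ν| ≤ ∫ s in Set.Ici R, M * q s ∂ν := by
          rw [← Real.norm_eq_abs]
          refine norm_integral_le_of_norm_le (hqi.const_mul M).integrableOn
            (Eventually.of_forall fun s => ?_)
          rw [Real.norm_eq_abs, abs_mul, abs_of_nonneg (hq s)]
          exact mul_le_mul_of_nonneg_right (hp s) (hq s)
      _ = M * ∫ s in Set.Ici R, q s ∂ν := integral_const_mul _ _
      _ ≤ M * (ε / (4 * (M + 1))) := by gcongr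
      _ ≤ ε / 4 := by
          rw [mul_div_assoc', div_le_div_iff₀ (by positivity) (by positivity)]
          nlinarith
  obtain ⟨D, hD⟩ := hbd R
  have hfinR : ν (Set.Iio R) < ⊤ := (measure_mono Set.Iio_subset_Iic_self).trans_lt (hfin R)
  have hmain : Tendsto (fun k => ∫ s in Set.Iio R, κ k s * f k s ∂ν) atTop
      (nhds (∫ s in Set.Iio R, κ' s * g s ∂ν)) := by
    refine tendsto_integral_of_dominated_convergence (fun _ => M * D)
      (fun k => (hi k).1.restrict) ?_ (fun k => ?_) ?_
    · exact integrableOn_const hfinR.ne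
    · refine (ae_restrict_iff' measurableSet_Iio).2 (Eventually.of_forall fun s hs => ?_)
      rw [Real.norm_eq_abs, abs_mul, abs_of_nonneg (hf0 k s)]
      exact mul_le_mul (hκM k s) (hD k s hs) (hf0 k s) hM
    · exact Eventually.of_forall fun s => (hκ s).mul (hlim s)
  obtain ⟨K, hK⟩ := Metric.tendsto_atTop.1 hmain (ε / 2) (by positivity)
  refine ⟨K, fun k hk => ?_⟩
  have h1 := hK k hk
  have h2 := tailbd _ _ (hκM k) (hf0 k) (hfi k) (hR k)
  have h3 := tailbd _ _ hκ'M hg0 hg hRg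
  have e1 := integral_add_compl (measurableSet_Iio (a := R)) (hi k)
  have e2 := integral_add_compl (measurableSet_Iio (a := R)) hi'
  rw [Set.compl_Iio] at e1 e2
  rw [Real.dist_eq, abs_lt] at h1
  rw [abs_le] at h2 h3
  rw [Real.dist_eq, ← e1, ← e2, abs_lt]
  constructor <;> linarith [h1.1, h1.2, h2.1, h2.2, h3.1, h3.2]

namespace IsQuantSol

variable {b : ℝ} {ν : Measure ℝ} {n : ℕ} {u : ℝ → ℝ}

lemma exp_zero_le (h : IsQuantSol b ν n u) (hb : 0 ≤ b) (hfin : ∀ R, ν (Set.Iic R) < ⊤)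
    {P : ℕ} (hP : 0 < ν.real (Set.Icc (-(P : ℝ)) P)) (hn : P < n) :
    Real.exp (u 0) ≤ Real.exp (b * (P + 1)) / ν.real (Set.Icc (-(P : ℝ)) P) := by
  have hn0 : 0 < n := by omega
  have hnP : (P : ℝ) + 1 ≤ n := by exact_mod_cast hn
  have hlt : ν (Set.Icc (-(P : ℝ)) P) < ⊤ := (measure_mono Set.Icc_subset_Iic_self).trans_lt (hfin P)
  have h1 : ∫ s in Set.Icc (-(P : ℝ)) P, Real.exp (u 0 - b * (P + 1)) ∂ν ≤ 1 := by
    refine le_of_le_of_eq ?_ h.integral_eq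
    refine (setIntegral_mono_on (integrableOn_const hlt.ne) h.integrable.integrableOn
      measurableSet_Icc fun s hs => ?_).trans (setIntegral_le_integral h.integrable
        (Eventually.of_forall fun s => quantWeight_nonneg n u s))
    have hsn : s ∈ Set.Iio (n : ℝ) := lt_of_le_of_lt hs.2 (by linarith)
    rw [quantWeight, Set.indicator_of_mem hsn]
    have h2 : quant n s ≤ s := quant_le hn0 (by linarith [hs.1])
    have h3 := lt_quant hn0 s
    have h4 : (1 : ℝ) / n ≤ 1 := by
      rw [div_le_one (by exact_mod_cast hn0)]; exact_mod_cast hn0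
    have h5 := (abs_le.1 (h.abs_sub_le hb (quant n s) 0)).1
    have h6 : b * |quant n s - 0| ≤ b * (P + 1) := by
      refine mul_le_mul_of_nonneg_left (abs_le.2 ⟨?_, ?_⟩) hb <;> linarith [hs.1, hs.2]
    exact Real.exp_le_exp.2 (by linarith)
  rw [setIntegral_const, smul_eq_mul, Real.exp_sub] at h1
  rw [le_div_iff₀ hP]
  have := (div_le_one (Real.exp_pos (b * (P + 1)))).1 (by rwa [mul_div_assoc'] at h1)
  linarith

lemma le_of_lt (h : IsQuantSol b ν n u) (hb : 0 ≤ b) (hn : 0 < n) {R : ℝ} (hR : 0 ≤ R) {s : ℝ}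
    (hs : s < R) : quantWeight n u s ≤ Real.exp (u 0) * Real.exp (b * R) := by
  refine (quantWeight_le n u s).trans ?_
  rw [← Real.exp_add]
  refine Real.exp_le_exp.2 ((h.le_add hb _).trans ?_)
  have h1 := quant_le_max hn s
  have h2 : max s (-(n : ℝ)) ≤ R := max_le hs.le (by
    have : (0 : ℝ) ≤ n := Nat.cast_nonneg n
    linarith)
  gcongr
  exact max_le (h1.trans h2) hR

lemma half_le (h : IsQuantSol b ν n u) (hb : 0 ≤ b) (hn : 0 < n)
    (hfin : ∀ R, ν (Set.Iic R) < ⊤) {R : ℝ} (hR : 0 ≤ R)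
    (htail : ∫ s in Set.Ici R, quantWeight n u s ∂ν ≤ 1 / 2) :
    1 / 2 ≤ Real.exp (u 0) * (Real.exp (b * R) * ν.real (Set.Iio R)) := by
  have hlt : ν (Set.Iio R) < ⊤ := (measure_mono Set.Iio_subset_Iic_self).trans_lt (hfin R)
  have e := integral_add_compl (measurableSet_Iio (a := R)) h.integrable
  rw [Set.compl_Iio, h.integral_eq] at e
  have h1 : ∫ s in Set.Iio R, quantWeight n u s ∂ν ≤
      ∫ s in Set.Iio R, Real.exp (u 0) * Real.exp (b * R) ∂ν :=
    setIntegral_mono_on h.integrable.integrableOn (integrableOn_const hlt.ne) measurableSet_Iio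
      fun s hs => h.le_of_lt hb hn hR hs
  rw [setIntegral_const, smul_eq_mul] at h1
  nlinarith

end IsQuantSol

lemma tendsto_setIntegral_Ici_zero {ν : Measure ℝ} {f : ℝ → ℝ}
    (hf : IntegrableOn f (Set.Ici 0) ν) :
    Tendsto (fun R => ∫ s in Set.Ici R, f s ∂ν) atTop (nhds 0) := by
  have := tendsto_setIntegral_of_antitone (μ := ν) (f := f) (s := fun R : ℝ => Set.Ici R)
    (fun R => measurableSet_Ici) (fun a b hab => Set.Ici_subset_Ici.2 hab) ⟨0, hf⟩
  have he : ⋂ R : ℝ, Set.Ici R = ∅ := by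
    ext x
    simp only [Set.mem_iInter, Set.mem_Ici, Set.mem_empty_iff_false, iff_false, not_forall, not_le]
    exact ⟨x + 1, by linarith⟩
  rwa [he, setIntegral_empty] at this

/-- `u` solves the integrated radial equation in logarithmic coordinates, with total mass one. -/
structure IsLogSol (b : ℝ) (ν : Measure ℝ) (u : ℝ → ℝ) : Prop where
  continuous : Continuous u
  integrable : Integrable (fun s => Real.exp (u s)) ν
  integral_eq : ∫ s, Real.exp (u s) ∂ν = 1
  eq : ∀ τ, u τ = u 0 + b * ∫ s, (max τ s - max 0 s) * Real.exp (u s) ∂ν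

/-- Existence for the integrated radial equation in logarithmic coordinates. -/
theorem exists_log_radial_solution {b : ℝ} (hb : 0 < b) {ν : Measure ℝ}
    (hfin : ∀ R, ν (Set.Iic R) < ⊤)
    (hexp : ∀ a < b, IntegrableOn (fun s => Real.exp (a * s)) (Set.Ici 0) ν) (hne : ν ≠ 0) :
    ∃ u : ℝ → ℝ, IsLogSol b ν u := by
  obtain ⟨P, hP⟩ : ∃ P : ℕ, 0 < ν.real (Set.Icc (-(P : ℝ)) P) := by
    by_contra! hcon
    refine hne (Measure.measure_univ_eq_zero.1 ?_)
    have hun : (Set.univ : Set ℝ) = ⋃ P : ℕ, Set.Icc (-(P : ℝ)) P := by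
      symm
      rw [Set.eq_univ_iff_forall]
      intro x
      obtain ⟨P, hP⟩ := exists_nat_ge |x|
      exact Set.mem_iUnion.2 ⟨P, abs_le.1 hP⟩
    rw [hun, measure_iUnion_null_iff]
    intro P
    have h0 := le_antisymm (hcon P) measureReal_nonneg
    rcases (ENNReal.toReal_eq_zero_iff _).1 h0 with h | h
    · exact h
    · exact absurd h ((measure_mono Set.Icc_subset_Iic_self).trans_lt (hfin P)).ne
  have hex : ∀ k : ℕ, ∃ u, IsQuantSol b ν (P + 1 + k) u := by
    intro k
    refine exists_isQuantSol hb.le hfin (by omega) fun h0 => ?_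
    have : ν (Set.Icc (-(P : ℝ)) P) = 0 := measure_mono_null (fun s hs => by
      have := hs.2
      have hk : (0 : ℝ) ≤ k := Nat.cast_nonneg k
      simp only [Set.mem_Iio]; push_cast; linarith) h0
    simp [Measure.real, this] at hP
  choose w hw using hex
  set A := Real.exp (b * (P + 1)) / ν.real (Set.Icc (-(P : ℝ)) P)
  have hA : ∀ k, Real.exp (w k 0) ≤ A := fun k =>
    (hw k).exp_zero_le hb.le hfin hP (by omega)
  have hA0 : 0 < A := (Real.exp_pos _).trans_le (hA 0)
  have htail : ∀ ε > 0, ∃ R, 1 ≤ R ∧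
      ∀ k, ∫ s in Set.Ici R, quantWeight (P + 1 + k) (w k) s ∂ν ≤ ε := by
    intro ε hε
    have hi := hexp (b * (1 - min (ε / 2) (1 / 2))) (by
      have : 0 < min (ε / 2) (1 / 2) := by positivity
      nlinarith)
    have hev := (tendsto_setIntegral_Ici_zero hi).eventually
      (gt_mem_nhds (show (0 : ℝ) < ε / (2 * A) by positivity))
    obtain ⟨R, hR1, hR2⟩ := (hev.and (eventually_ge_atTop 1)).exists
    refine ⟨R, hR2, fun k => ?_⟩
    refine ((hw k).tail_le hb.le (by omega) (hA k) (δ := min (ε / 2) (1 / 2)) (by positivity) hR2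
      (hi.mono_set (Set.Ici_subset_Ici.2 (by linarith)))).trans ?_
    have h1 := min_le_left (ε / 2) (1 / 2 : ℝ)
    have h2 := mul_le_mul_of_nonneg_left hR1.le hA0.le
    have h3 : A * (ε / (2 * A)) = ε / 2 := by field_simp
    linarith
  obtain ⟨B, hB⟩ : ∃ B, ∀ k, |w k 0| ≤ B := by
    obtain ⟨R, hR1, hR⟩ := htail (1 / 2) (by norm_num)
    set D := Real.exp (b * R) * ν.real (Set.Iio R)
    have hD : ∀ k, 1 / 2 ≤ Real.exp (w k 0) * D := fun k =>
      (hw k).half_le hb.le (by omega) hfin (by linarith) (hR k)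
    have hD0 : 0 < D := by
      by_contra hcon
      have := mul_nonpos_of_nonneg_of_nonpos (Real.exp_pos (w 0 0)).le (not_lt.1 hcon)
      linarith [hD 0]
    refine ⟨max (Real.log A) (-Real.log (1 / 2 / D)), fun k => abs_le.2 ⟨?_, ?_⟩⟩
    · have h1 : Real.log (1 / 2 / D) ≤ w k 0 := by
        rw [Real.log_le_iff_le_exp (by positivity), div_le_iff₀ hD0]; exact hD k
      linarith [le_max_right (Real.log A) (-Real.log (1 / 2 / D))]
    · exact ((Real.le_log_iff_exp_le hA0).2 (hA k)).trans (le_max_left _ _)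
  obtain ⟨φ, u, hφ, hu⟩ := exists_subseq_tendsto_of_lipschitz hb.le
    (fun k => (hw k).abs_sub_le hb.le) hB
  have hn : Tendsto (fun k => P + 1 + φ k) atTop atTop :=
    tendsto_atTop_mono (fun k => (hφ.le_apply).trans (Nat.le_add_left _ _)) tendsto_id
  have hq : ∀ s, Tendsto (fun k => quant (P + 1 + φ k) s) atTop (nhds s) := fun s =>
    (tendsto_quant s).comp hn
  have hlim : ∀ s, Tendsto (fun k => quantWeight (P + 1 + φ k) (w (φ k)) s) atTop
      (nhds (Real.exp (u s))) := by
    intro s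
    have h1 : Tendsto (fun k => w (φ k) (quant (P + 1 + φ k) s) - w (φ k) s) atTop (nhds 0) := by
      refine squeeze_zero_norm (fun k => (hw (φ k)).abs_sub_le hb.le _ _) ?_
      have := (((hq s).sub_const s).abs).const_mul b
      simpa using this
    have h2 : Tendsto (fun k => w (φ k) (quant (P + 1 + φ k) s)) atTop (nhds (u s)) := by
      simpa using h1.add (hu s)
    refine ((Real.continuous_exp.tendsto _).comp h2).congr' ?_
    obtain ⟨N, hN⟩ := exists_nat_gt s
    filter_upwards [hn.eventually_ge_atTop N] with k hk
    have : s ∈ Set.Iio ((P + 1 + φ k : ℕ) : ℝ) := hN.trans_le (by exact_mod_cast hk)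
    rw [quantWeight, Set.indicator_of_mem this]
    rfl
  obtain ⟨hint, hconv⟩ := integrable_and_tendsto_of_tight hfin
    (f := fun k => quantWeight (P + 1 + φ k) (w (φ k))) (g := fun s => Real.exp (u s))
    (fun k s => quantWeight_nonneg _ _ _) (fun k => (hw (φ k)).integrable)
    (fun k => (hw (φ k)).integral_eq) hlim
    (fun R => ⟨A * Real.exp (b * max R 0), fun k s hs =>
      ((hw (φ k)).le_of_lt hb.le (by omega) (le_max_right R 0)
        (hs.trans_le (le_max_left R 0))).trans (by gcongr; exact hA _)⟩)
    (fun ε hε => (htail ε hε).imp fun R hR k => hR.2 (φ k))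
  have hlipu : ∀ τ τ', |u τ - u τ'| ≤ b * |τ - τ'| := fun τ τ' =>
    le_of_tendsto' ((hu τ).sub (hu τ')).abs fun k => (hw (φ k)).abs_sub_le hb.le τ τ'
  refine ⟨u, ?_, hint, ?_, fun τ => ?_⟩
  · exact (LipschitzWith.of_dist_le_mul (K := ⟨b, hb.le⟩) fun x y => by
      rw [Real.dist_eq, Real.dist_eq]; exact hlipu x y).continuous
  · have h1 := hconv 1 (fun _ _ => 1) (fun _ => 1) (fun _ => aestronglyMeasurable_const)
      (fun _ _ => by simp) (fun _ => tendsto_const_nhds)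
    simp only [one_mul, (hw _).integral_eq] at h1
    exact tendsto_nhds_unique h1 tendsto_const_nhds
  · have h1 := hconv |τ| (fun k s => max τ (quant (P + 1 + φ k) s) - max 0 (quant (P + 1 + φ k) s))
      (fun s => max τ s - max 0 s) (fun k => by
        have := measurable_quant (P + 1 + φ k)
        exact Measurable.aestronglyMeasurable (by fun_prop))
      (fun k s => by simpa using abs_kernel_le τ 0 (quant (P + 1 + φ k) s))
      (fun s => (tendsto_const_nhds.max (hq s)).sub (tendsto_const_nhds.max (hq s)))
    refine tendsto_nhds_unique (hu τ) ?_
    refine ((hu 0).add (h1.const_mul b)).congr fun k => ?_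
    exact ((hw (φ k)).eq τ).symm

/-- Mass to the left of `t`. -/
def leftMass (ν : Measure ℝ) (u : ℝ → ℝ) (t : ℝ) : ℝ := ∫ s in Set.Iic t, Real.exp (u s) ∂ν

namespace IsLogSol

variable {b : ℝ} {ν : Measure ℝ} {u : ℝ → ℝ}

lemma integrable_kernel (h : IsLogSol b ν u) (τ : ℝ) :
    Integrable (fun s => (max τ s - max 0 s) * Real.exp (u s)) ν := by
  refine h.integrable.bdd_mul (c := |τ - 0|) ?_ (Eventually.of_forall fun s => ?_)
  · exact Measurable.aestronglyMeasurable (by fun_prop)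
  · exact abs_kernel_le _ _ _

lemma leftMass_nonneg (t : ℝ) : 0 ≤ leftMass ν u t := integral_nonneg fun _ => (Real.exp_pos _).le

lemma leftMass_le_one (h : IsLogSol b ν u) (t : ℝ) : leftMass ν u t ≤ 1 := by
  rw [← h.integral_eq]
  exact setIntegral_le_integral h.integrable (Eventually.of_forall fun _ => (Real.exp_pos _).le)

lemma continuous_leftMass [NullSingletonClass ν] (h : IsLogSol b ν u) : Continuous (leftMass ν u) := by
  have he : leftMass ν u = fun t => ∫ s, (Set.Iic t).indicator (fun s => Real.exp (u s)) s ∂ν := by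
    ext t
    rw [leftMass, integral_indicator measurableSet_Iic]
  rw [he, continuous_iff_continuousAt]
  intro t
  refine continuousAt_of_dominated (bound := fun s => Real.exp (u s))
    (Eventually.of_forall fun t => h.integrable.1.indicator measurableSet_Iic)
    (Eventually.of_forall fun t => Eventually.of_forall fun s => ?_) h.integrable ?_
  · rw [Real.norm_eq_abs, abs_of_nonneg (Set.indicator_nonneg (fun _ _ => (Real.exp_pos _).le) _)]
    exact Set.indicator_le_self' (fun _ _ => (Real.exp_pos _).le) s
  · filter_upwards [Measure.ae_ne ν t] with s hs
    rcases lt_or_gt_of_ne hs with hlt | hlt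
    · refine (continuousAt_const (y := Real.exp (u s))).congr ?_
      filter_upwards [lt_mem_nhds hlt] with x hx
      rw [Set.indicator_of_mem (show s ∈ Set.Iic x from hx.le)]
    · refine (continuousAt_const (y := (0 : ℝ))).congr ?_
      filter_upwards [gt_mem_nhds hlt] with x hx
      rw [Set.indicator_of_notMem (show s ∉ Set.Iic x from not_le.2 hx)]

lemma hasDerivAt [NullSingletonClass ν] (h : IsLogSol b ν u) (t : ℝ) :
    HasDerivAt u (b * leftMass ν u t) t := by
  suffices H : HasDerivAt (fun τ => ∫ s, (max τ s - max 0 s) * Real.exp (u s) ∂ν)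
      (leftMass ν u t) t from
    ((H.const_mul b).const_add (u 0)).congr_of_eventuallyEq (Eventually.of_forall h.eq)
  rw [leftMass, ← integral_indicator measurableSet_Iic]
  refine (hasDerivAt_integral_of_dominated_loc_of_lip (bound := fun s => Real.exp (u s))
    Filter.univ_mem (Eventually.of_forall fun τ => (h.integrable_kernel τ).1)
    (h.integrable_kernel t) (h.integrable.1.indicator measurableSet_Iic)
    (Eventually.of_forall fun s => ?_) h.integrable ?_).2
  · refine LipschitzOnWith.of_dist_le_mul fun x _ y _ => ?_
    rw [Real.dist_eq, Real.dist_eq, ← sub_mul, abs_mul, Real.coe_nnabs, mul_comm]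
    refine mul_le_mul_of_nonneg_left ?_ (abs_nonneg _)
    rw [sub_sub_sub_cancel_right]
    exact abs_kernel_le _ _ _
  · filter_upwards [Measure.ae_ne ν t] with s hs
    rcases lt_or_gt_of_ne hs with hlt | hlt
    · rw [Set.indicator_of_mem (show s ∈ Set.Iic t from hlt.le)]
      have h1 : HasDerivAt (fun τ : ℝ => (τ - max 0 s) * Real.exp (u s)) (Real.exp (u s)) t := by
        simpa using ((hasDerivAt_id t).sub_const (max 0 s)).mul_const (Real.exp (u s))
      refine h1.congr_of_eventuallyEq ?_
      filter_upwards [lt_mem_nhds hlt] with x hx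
      rw [max_eq_left hx.le]
    · rw [Set.indicator_of_notMem (show s ∉ Set.Iic t from not_le.2 hlt)]
      refine (hasDerivAt_const t ((s - max 0 s) * Real.exp (u s))).congr_of_eventuallyEq ?_
      filter_upwards [gt_mem_nhds hlt] with x hx
      rw [max_eq_right hx.le]

lemma monotone [NullSingletonClass ν] (h : IsLogSol b ν u) (hb : 0 ≤ b) : Monotone u :=
  monotone_of_deriv_nonneg (fun t => (h.hasDerivAt t).differentiableAt) fun t => by
    rw [(h.hasDerivAt t).deriv]
    exact mul_nonneg hb (leftMass_nonneg t)

lemma contDiff [NullSingletonClass ν] (h : IsLogSol b ν u) : ContDiff ℝ 1 u := by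
  rw [contDiff_one_iff_deriv]
  refine ⟨fun t => (h.hasDerivAt t).differentiableAt, ?_⟩
  rw [show deriv u = fun t => b * leftMass ν u t from funext fun t => (h.hasDerivAt t).deriv]
  exact continuous_const.mul h.continuous_leftMass

lemma abs_le (h : IsLogSol b ν u) (hb : 0 ≤ b) (t : ℝ) : |u t| ≤ |u 0| + b * |t| := by
  have hI : |∫ s, (max t s - max 0 s) * Real.exp (u s) ∂ν| ≤ |t| :=
    calc |∫ s, (max t s - max 0 s) * Real.exp (u s) ∂ν| ≤ ∫ s, |t| * Real.exp (u s) ∂ν := by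
          rw [← Real.norm_eq_abs]
          refine norm_integral_le_of_norm_le (h.integrable.const_mul _)
            (Eventually.of_forall fun s => ?_)
          rw [Real.norm_eq_abs, abs_mul, abs_of_pos (Real.exp_pos _)]
          refine mul_le_mul_of_nonneg_right ?_ (Real.exp_pos _).le
          simpa only [sub_zero] using abs_kernel_le t 0 s
      _ = |t| := by rw [integral_const_mul, h.integral_eq, mul_one]
  calc |u t| = |u 0 + b * ∫ s, (max t s - max 0 s) * Real.exp (u s) ∂ν| := congrArg _ (h.eq t)
    _ ≤ |u 0| + |b * ∫ s, (max t s - max 0 s) * Real.exp (u s) ∂ν| := abs_add_le _ _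
    _ ≤ |u 0| + b * |t| := by
        rw [abs_mul, abs_of_nonneg hb]
        exact add_le_add le_rfl (mul_le_mul_of_nonneg_left hI hb)

lemma tendsto_div (h : IsLogSol b ν u) : Tendsto (fun t => u t / t) atTop (nhds b) := by
  have h1 : Tendsto (fun t => ∫ s, (max t s - max 0 s) / t * Real.exp (u s) ∂ν) atTop
      (nhds (∫ s, Real.exp (u s) ∂ν)) := by
    refine tendsto_integral_filter_of_dominated_convergence (fun s => Real.exp (u s))
      (Eventually.of_forall fun t => ?_) ?_ h.integrable (Eventually.of_forall fun s => ?_)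
    · exact AEStronglyMeasurable.mul (Measurable.aestronglyMeasurable (by fun_prop)) h.integrable.1
    · filter_upwards [eventually_gt_atTop 0] with t ht
      refine Eventually.of_forall fun s => ?_
      rw [Real.norm_eq_abs, abs_mul, abs_of_pos (Real.exp_pos _), abs_div, abs_of_pos ht]
      refine mul_le_of_le_one_left (Real.exp_pos _).le ((div_le_one ht).2 ?_)
      simpa [abs_of_pos ht] using abs_kernel_le t 0 s
    · have h2 : Tendsto (fun t : ℝ => 1 - max 0 s / t) atTop (nhds (1 - 0)) :=
        tendsto_const_nhds.sub (tendsto_const_nhds.div_atTop tendsto_id)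
      have h3 : Tendsto (fun t : ℝ => (max t s - max 0 s) / t) atTop (nhds 1) := by
        rw [sub_zero] at h2
        refine h2.congr' ?_
        filter_upwards [eventually_gt_atTop 0, eventually_ge_atTop s] with t ht hts
        rw [max_eq_left hts, sub_div, div_self ht.ne']
      simpa using h3.mul_const (Real.exp (u s))
  rw [h.integral_eq] at h1
  have h4 : Tendsto (fun t : ℝ => u 0 / t) atTop (nhds 0) :=
    tendsto_const_nhds.div_atTop tendsto_id
  have h5 := h4.add (h1.const_mul b)
  rw [zero_add, mul_one] at h5
  refine h5.congr fun t => ?_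
  have h6 : ∫ s, (max t s - max 0 s) / t * Real.exp (u s) ∂ν =
      (∫ s, (max t s - max 0 s) * Real.exp (u s) ∂ν) / t := by
    rw [← integral_div]
    congr 1; ext s; ring
  rw [h6, h.eq t]
  ring

/-- Near `-∞` the mass decays quadratically in the drop of `u`. -/
lemma leftMass_mul_sq_le [NullSingletonClass ν] (h : IsLogSol b ν u) (hb : 0 ≤ b)
    (hfin : ∀ R, ν (Set.Iic R) < ⊤) {t T : ℝ} (htT : t ≤ T) :
    leftMass ν u t * (1 + (u T - u t)) ^ 2 ≤ 4 * Real.exp (u T) * ν.real (Set.Iic T) := by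
  have hmono := h.monotone hb
  have hD : 0 ≤ u T - u t := sub_nonneg.2 (hmono htT)
  calc leftMass ν u t * (1 + (u T - u t)) ^ 2
      = ∫ s in Set.Iic t, Real.exp (u s) * (1 + (u T - u t)) ^ 2 ∂ν := by
        rw [integral_mul_const, leftMass]
    _ ≤ ∫ s in Set.Iic t, 4 * Real.exp (u T) ∂ν := by
        refine setIntegral_mono_on (h.integrable.mul_const _).integrableOn
          (integrableOn_const (hfin t).ne) measurableSet_Iic fun s hs => ?_
        have hs' : u s ≤ u t := hmono hs
        have h1 : 1 + (u T - u t) ≤ 2 * Real.exp ((u T - u s) / 2) := by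
          have := Real.add_one_le_exp ((u T - u s) / 2)
          linarith
        calc Real.exp (u s) * (1 + (u T - u t)) ^ 2
            ≤ Real.exp (u s) * (2 * Real.exp ((u T - u s) / 2)) ^ 2 := by gcongr
          _ = 4 * (Real.exp (u s) * (Real.exp ((u T - u s) / 2) * Real.exp ((u T - u s) / 2))) := by
              ring
          _ = 4 * Real.exp (u T) := by
              rw [← Real.exp_add, ← Real.exp_add]; congr 2; ring
    _ = 4 * Real.exp (u T) * ν.real (Set.Iic t) := by
        rw [setIntegral_const, smul_eq_mul]; ring
    _ ≤ _ := by
        gcongr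
        exact (hfin T).ne

/-- Finiteness of the Dirichlet energy near the origin. -/
lemma integrableOn_leftMass_sq [NullSingletonClass ν] (h : IsLogSol b ν u) (hb : 0 < b)
    (hfin : ∀ R, ν (Set.Iic R) < ⊤) {R : ℝ} (hR : 0 < R) :
    IntegrableOn (fun r => leftMass ν u (Real.log r) ^ 2 / r) (Set.Ioo 0 R) := by
  have hmono := h.monotone hb.le
  set D : ℝ → ℝ := fun r => u (Real.log R) - u (Real.log r) with hDdef
  have hD : ∀ r, 0 < r → r ≤ R → 0 ≤ D r := fun r hr hrR =>
    sub_nonneg.2 (hmono (Real.log_le_log hr hrR))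
  let G : ℝ → ℝ := fun r => if r ≤ 0 then 0 else (1 + D r)⁻¹
  have hG : MonotoneOn G (Set.uIcc 0 R) := by
    rw [Set.uIcc_of_le hR.le]
    intro x hx y hy hxy
    simp only [G]
    by_cases hy0 : y ≤ 0
    · rw [if_pos hy0, if_pos (hxy.trans hy0)]
    · rw [if_neg hy0]
      have := hD y (not_le.1 hy0) hy.2
      by_cases hx0 : x ≤ 0
      · rw [if_pos hx0]; positivity
      · rw [if_neg hx0]
        refine inv_anti₀ (by positivity) ?_
        simp only [hDdef]
        have := hmono (Real.log_le_log (not_le.1 hx0) hxy)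
        linarith
  have hGi := hG.intervalIntegrable_deriv
  rw [intervalIntegrable_iff_integrableOn_Ioo_of_le hR.le] at hGi
  set K := 4 * Real.exp (u (Real.log R)) * ν.real (Set.Iic (Real.log R))
  refine Integrable.mono' (hGi.const_mul (K / b)) ?_ ?_
  · have := h.continuous_leftMass.measurable
    exact Measurable.aestronglyMeasurable (by fun_prop)
  · refine (ae_restrict_iff' measurableSet_Ioo).2 (Eventually.of_forall fun r hr => ?_)
    have hr0 : 0 < r := hr.1
    have hDr := hD r hr0 hr.2.le
    have hder : HasDerivAt G (b * leftMass ν u (Real.log r) * r⁻¹ / (1 + D r) ^ 2) r := by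
      have h1 : HasDerivAt (fun r => u (Real.log r)) (b * leftMass ν u (Real.log r) * r⁻¹) r :=
        (h.hasDerivAt (Real.log r)).comp r (Real.hasDerivAt_log hr0.ne')
      have h2 := ((h1.const_sub (u (Real.log R))).const_add 1).inv
        (show 1 + D r ≠ 0 by positivity)
      rw [neg_neg] at h2
      refine h2.congr_of_eventuallyEq ?_
      filter_upwards [lt_mem_nhds hr0] with x hx
      simp only [G, if_neg (not_le.2 hx)]
      rfl
    have hm := leftMass_nonneg (ν := ν) (u := u) (Real.log r)
    have hle := h.leftMass_mul_sq_le hb.le hfin (Real.log_le_log hr0 hr.2.le)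
    rw [hder.deriv, Real.norm_eq_abs, abs_of_nonneg (by positivity)]
    have h3 : K / b * (b * leftMass ν u (Real.log r) * r⁻¹ / (1 + D r) ^ 2) =
        K / (1 + D r) ^ 2 * leftMass ν u (Real.log r) / r := by field_simp
    rw [h3, sq]
    gcongr
    rwa [le_div_iff₀ (by positivity)]

end IsLogSol

namespace IsLogSol

variable {b : ℝ} {ν : Measure ℝ} {u : ℝ → ℝ}

lemma integrableOn_comp_log (h : IsLogSol b ν u) (hb : 0 ≤ b) {L : ℝ} (hL : 0 ≤ L) :
    IntegrableOn (fun r => u (Real.log r)) (Set.Icc 0 L) := by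
  have hlog : IntegrableOn Real.log (Set.Icc 0 L) := by
    rw [integrableOn_Icc_iff_integrableOn_Ioc, ← intervalIntegrable_iff_integrableOn_Ioc_of_le hL]
    exact intervalIntegral.intervalIntegrable_log'
  refine Integrable.mono' ((integrableOn_const (C := |u 0|) (by simp)).add
    (hlog.abs.const_mul b)) ?_ (Eventually.of_forall fun r => h.abs_le hb _)
  exact (h.continuous.measurable.comp Real.measurable_log).aestronglyMeasurable

lemma integrableOn_comp_log_mul (h : IsLogSol b ν u) (hb : 0 ≤ b) {g : ℝ → ℝ} (hg : Continuous g)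
    {L : ℝ} (hL : 0 ≤ L) (hgL : ∀ r, L ≤ r → g r = 0) :
    IntegrableOn (fun r => u (Real.log r) * g r) (Set.Ioi 0) := by
  refine ((h.integrableOn_comp_log hb hL).mul_continuousOn hg.continuousOn
    isCompact_Icc).of_forall_sdiff_eq_zero measurableSet_Ioi fun r hr => ?_
  have hr' : L ≤ r := le_of_not_ge fun hle => hr.2 ⟨(show (0 : ℝ) < r from hr.1).le, hle⟩
  rw [hgL r hr', mul_zero]

/-- Testing the radial equation against a compactly supported function. -/
lemma integral_leftMass_mul_deriv [SFinite ν] (h : IsLogSol b ν u)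
    {f f' : ℝ → ℝ} (hf : ∀ r, HasDerivAt f (f' r) r) (hc : Continuous f') {L : ℝ}
    (hfL : ∀ r, L ≤ r → f r = 0) (hfL' : ∀ r, L ≤ r → f' r = 0) :
    ∫ r in Set.Ioi 0, leftMass ν u (Real.log r) * f' r =
      -∫ s, f (Real.exp s) * Real.exp (u s) ∂ν := by
  have hfi : IntegrableOn f' (Set.Ici 0) := by
    refine (hc.integrableOn_Icc (a := 0) (b := L)).of_forall_sdiff_eq_zero measurableSet_Ici
      fun r hr => hfL' r (le_of_not_ge fun hle => hr.2 ⟨hr.1, hle⟩)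
  let A : Set (ℝ × ℝ) := {p | p.2 ≤ Real.log p.1}
  have hA : MeasurableSet A :=
    measurableSet_le measurable_snd (Real.measurable_log.comp measurable_fst)
  have hprod : Integrable (Function.uncurry fun r s =>
      A.indicator (fun p => f' p.1 * Real.exp (u p.2)) (r, s))
      ((volume.restrict (Set.Ioi 0)).prod ν) :=
    (Integrable.mul_prod (hfi.mono_set Set.Ioi_subset_Ici_self) h.integrable).indicator hA
  calc ∫ r in Set.Ioi 0, leftMass ν u (Real.log r) * f' r
      = ∫ r in Set.Ioi 0, ∫ s, A.indicator (fun p => f' p.1 * Real.exp (u p.2)) (r, s) ∂ν := by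
        congr 1; ext r
        have : (fun s => A.indicator (fun p => f' p.1 * Real.exp (u p.2)) (r, s)) =
            (Set.Iic (Real.log r)).indicator fun s => f' r * Real.exp (u s) := by
          ext s; rfl
        rw [this, integral_indicator measurableSet_Iic, integral_const_mul, mul_comm, leftMass]
    _ = ∫ s, (∫ r in Set.Ioi 0, A.indicator (fun p => f' p.1 * Real.exp (u p.2)) (r, s)) ∂ν :=
        integral_integral_swap hprod
    _ = ∫ s, -(f (Real.exp s) * Real.exp (u s)) ∂ν := by
        congr 1; ext s
        have h1 : ∫ r in Set.Ioi 0, A.indicator (fun p => f' p.1 * Real.exp (u p.2)) (r, s) =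
            ∫ r in Set.Ioi 0, (Set.Ici (Real.exp s)).indicator (fun r => f' r * Real.exp (u s)) r := by
          refine setIntegral_congr_fun measurableSet_Ioi fun r hr => ?_
          simp only [Set.indicator, A, Set.mem_Ici]
          refine if_congr ?_ rfl rfl
          exact Real.le_log_iff_exp_le hr
        have h2 : Set.Ici (Real.exp s) ⊆ Set.Ioi 0 := Set.Ici_subset_Ioi.2 (Real.exp_pos s)
        rw [h1, setIntegral_indicator measurableSet_Ici, Set.inter_eq_right.2 h2,
          integral_Ici_eq_integral_Ioi,
          integral_mul_const, integral_Ioi_of_hasDerivAt_of_tendsto' (fun r _ => hf r)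
            (hfi.mono_set fun r hr => ((Real.exp_pos s).trans hr).le)
            (tendsto_const_nhds.congr' (f₁ := fun _ => (0 : ℝ)) ?_)]
        · ring
        · filter_upwards [eventually_ge_atTop L] with r hr using (hfL r hr).symm
    _ = _ := integral_neg _

/-- Weak form of `(r u')' = b e^u ν` in the logarithmic variable. -/
lemma integral_comp_log_mul [SFinite ν] [NullSingletonClass ν] (h : IsLogSol b ν u) (hb : 0 ≤ b)
    {f f' f'' : ℝ → ℝ} (hf : ∀ r, HasDerivAt f (f' r) r) (hf' : ∀ r, HasDerivAt f' (f'' r) r)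
    (hc : Continuous f'') {L : ℝ} (hL : 0 ≤ L) (hfL : ∀ r, L ≤ r → f r = 0)
    (hfL' : ∀ r, L ≤ r → f' r = 0) (hfL'' : ∀ r, L ≤ r → f'' r = 0) :
    ∫ r in Set.Ioi 0, u (Real.log r) * (f' r + r * f'' r) =
      b * ∫ s, f (Real.exp s) * Real.exp (u s) ∂ν := by
  have hcf' : Continuous f' := continuous_iff_continuousAt.2 fun r => (hf' r).continuousAt
  have hm := h.continuous_leftMass.measurable
  have hU : ∀ r ∈ Set.Ioi (0 : ℝ), HasDerivAt (fun r => u (Real.log r))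
      (b * leftMass ν u (Real.log r) * r⁻¹) r := fun r hr =>
    (h.hasDerivAt (Real.log r)).comp r (Real.hasDerivAt_log (ne_of_gt hr))
  have hV : ∀ r ∈ Set.Ioi (0 : ℝ), HasDerivAt (fun r => r * f' r) (f' r + r * f'' r) r :=
    fun r _ => by simpa using (hasDerivAt_id' r).fun_mul (hf' r)
  have hcancel : ∀ r ∈ Set.Ioi (0 : ℝ), b * leftMass ν u (Real.log r) * r⁻¹ * (r * f' r) =
      b * (leftMass ν u (Real.log r) * f' r) := fun r hr => by
    have : r ≠ 0 := ne_of_gt hr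
    field_simp
  have hi1 : IntegrableOn ((fun r => u (Real.log r)) * fun r => f' r + r * f'' r) (Set.Ioi 0) :=
    h.integrableOn_comp_log_mul hb (by fun_prop) hL fun r hr => by
      rw [hfL' r hr, hfL'' r hr]; ring
  have hi2 : IntegrableOn ((fun r => b * leftMass ν u (Real.log r) * r⁻¹) * fun r => r * f' r)
      (Set.Ioi 0) := by
    have hfi : IntegrableOn f' (Set.Ioi 0) :=
      (hcf'.integrableOn_Icc (a := 0) (b := L)).of_forall_sdiff_eq_zero measurableSet_Ioi
        fun r hr => hfL' r (le_of_not_ge fun hle => hr.2 ⟨(show (0 : ℝ) < r from hr.1).le, hle⟩)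
    have : IntegrableOn (fun r => b * (leftMass ν u (Real.log r) * f' r)) (Set.Ioi 0) := by
      refine Integrable.const_mul (hfi.bdd_mul (c := 1) ?_ (Eventually.of_forall fun r => ?_)) b
      · exact (hm.comp Real.measurable_log).aestronglyMeasurable
      · rw [Real.norm_eq_abs, abs_of_nonneg (leftMass_nonneg _)]
        exact h.leftMass_le_one _
    exact this.congr_fun (fun r hr => (hcancel r hr).symm) measurableSet_Ioi
  have hb0 : Tendsto ((fun r => u (Real.log r)) * fun r => r * f' r) (nhdsWithin 0 (Set.Ioi 0))
      (nhds 0) := by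
    have h1 : Tendsto (fun r => (|u 0| * |r| + b * |r * Real.log r|) * |f' r|)
        (nhdsWithin 0 (Set.Ioi 0)) (nhds 0) := by
      have : Continuous fun r => (|u 0| * |r| + b * |r * Real.log r|) * |f' r| := by
        have := Real.continuous_mul_log
        fun_prop
      simpa using (this.tendsto 0).mono_left nhdsWithin_le_nhds
    refine squeeze_zero_norm (fun r => ?_) h1
    have := h.abs_le hb (Real.log r)
    calc ‖u (Real.log r) * (r * f' r)‖ = |u (Real.log r)| * |r| * |f' r| := by
          rw [Real.norm_eq_abs, abs_mul, abs_mul, mul_assoc]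
      _ ≤ (|u 0| + b * |Real.log r|) * |r| * |f' r| := by gcongr
      _ = _ := by rw [abs_mul]; ring
  have hbt : Tendsto ((fun r => u (Real.log r)) * fun r => r * f' r) atTop (nhds 0) := by
    refine tendsto_const_nhds.congr' ?_
    filter_upwards [eventually_ge_atTop L] with r hr
    simp [hfL' r hr]
  rw [integral_Ioi_mul_deriv_eq_deriv_mul hU hV hi1 hi2 hb0 hbt,
    setIntegral_congr_fun measurableSet_Ioi hcancel, integral_const_mul,
    h.integral_leftMass_mul_deriv hf hcf' hfL hfL']
  ring

end IsLogSol

/-- The image of `V dx` under `x ↦ log ‖x‖`. -/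
def logMeasure (V : R2 → ℝ) : Measure ℝ :=
  ((volume : Measure R2).withDensity fun x => ENNReal.ofReal (V x)).map fun x => Real.log ‖x‖

lemma measurable_log_norm : Measurable fun x : R2 => Real.log ‖x‖ := by fun_prop

instance (V : R2 → ℝ) : SFinite (logMeasure V) := by
  unfold logMeasure; infer_instance

lemma norm_le_exp_of_log_norm_le {x : R2} {R : ℝ} (h : Real.log ‖x‖ ≤ R) :
    ‖x‖ ≤ Real.exp R := by
  rcases (norm_nonneg x).eq_or_lt with h0 | h0
  · rw [← h0]; exact (Real.exp_pos _).le
  · rwa [← Real.log_le_iff_le_exp h0]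

instance (V : R2 → ℝ) : NullSingletonClass (logMeasure V) := by
  refine ⟨fun s => ?_⟩
  rw [logMeasure, Measure.map_apply measurable_log_norm (measurableSet_singleton s)]
  refine withDensity_absolutelyContinuous _ _ (measure_mono_null (t := sphere 0 (Real.exp s) ∪ {0})
    (fun x hx => ?_) ?_)
  · rcases (norm_nonneg x).eq_or_lt with h0 | h0
    · exact Or.inr (norm_eq_zero.1 h0.symm)
    · left
      have hx' : Real.log ‖x‖ = s := hx
      rw [mem_sphere_zero_iff_norm, ← hx', Real.exp_log h0]
  · exact measure_union_null (Measure.addHaar_sphere _ _ _) (measure_singleton _)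

section

variable {V : R2 → ℝ}

lemma integrableOn_logMeasure_iff (hV : AEMeasurable V) (hV0 : ∀ x, 0 ≤ V x) {F : ℝ → ℝ}
    (hF : Measurable F) {S : Set ℝ} (hS : MeasurableSet S) :
    IntegrableOn F S (logMeasure V) ↔
      IntegrableOn (fun x : R2 => V x * F (Real.log ‖x‖)) {x | Real.log ‖x‖ ∈ S} := by
  have hS' : MeasurableSet ((fun x : R2 => Real.log ‖x‖) ⁻¹' S) := measurable_log_norm hS
  rw [IntegrableOn, logMeasure, Measure.restrict_map measurable_log_norm hS,
    integrable_map_measure hF.aestronglyMeasurable measurable_log_norm.aemeasurable,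
    restrict_withDensity hS', integrable_withDensity_iff_integrable_smul₀'
      hV.ennreal_ofReal.restrict (Eventually.of_forall fun _ => ENNReal.ofReal_lt_top)]
  simp only [ENNReal.toReal_ofReal (hV0 _), smul_eq_mul, Function.comp_apply]
  rfl

lemma integrable_logMeasure_iff (hV : AEMeasurable V) (hV0 : ∀ x, 0 ≤ V x) {F : ℝ → ℝ}
    (hF : Measurable F) :
    Integrable F (logMeasure V) ↔ Integrable (fun x : R2 => V x * F (Real.log ‖x‖)) := by
  simpa using integrableOn_logMeasure_iff hV hV0 hF MeasurableSet.univ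

lemma integral_logMeasure (hV : AEMeasurable V) (hV0 : ∀ x, 0 ≤ V x) {F : ℝ → ℝ}
    (hF : Measurable F) :
    ∫ s, F s ∂(logMeasure V) = ∫ x : R2, V x * F (Real.log ‖x‖) := by
  rw [logMeasure, integral_map measurable_log_norm.aemeasurable hF.aestronglyMeasurable,
    integral_withDensity_eq_integral_toReal_smul₀ hV.ennreal_ofReal
      (Eventually.of_forall fun _ => ENNReal.ofReal_lt_top)]
  simp only [ENNReal.toReal_ofReal (hV0 _), smul_eq_mul]

lemma logMeasure_Iic_lt_top (hVloc : LocallyIntegrable V) (R : ℝ) :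
    logMeasure V (Set.Iic R) < ⊤ := by
  rw [logMeasure, Measure.map_apply measurable_log_norm measurableSet_Iic]
  refine (measure_mono (t := closedBall 0 (Real.exp R)) fun x hx => ?_).trans_lt ?_
  · rw [mem_closedBall_zero_iff]
    exact norm_le_exp_of_log_norm_le hx
  · rw [withDensity_apply _ measurableSet_closedBall]
    exact (hVloc.integrableOn_isCompact (isCompact_closedBall 0 _)).lintegral_lt_top

lemma integrableOn_exp_logMeasure (hVloc : LocallyIntegrable V) (hV0 : ∀ x, 0 ≤ V x) {B : ℝ}
    (hint : ∀ α : ℝ, α < B →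
      IntegrableOn (fun x : R2 => V x * ‖x‖ ^ (2*α)) {x : R2 | 1 ≤ ‖x‖}) {a : ℝ} (ha : a < 2 * B) :
    IntegrableOn (fun s => Real.exp (a * s)) (Set.Ici 0) (logMeasure V) := by
  rw [integrableOn_logMeasure_iff hVloc.aestronglyMeasurable.aemeasurable hV0 (by fun_prop)
    measurableSet_Ici]
  have h1 := hint (a / 2) (by linarith)
  have h2 : IntegrableOn (fun x : R2 => V x * Real.exp (a * Real.log ‖x‖)) {x : R2 | 1 ≤ ‖x‖} := by
    refine h1.congr_fun (fun x hx => ?_) (measurableSet_le measurable_const measurable_norm)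
    have hx' : 0 < ‖x‖ := zero_lt_one.trans_le hx
    simp only
    rw [Real.rpow_def_of_pos hx']
    congr 2; ring
  have h3 : (volume : Measure R2) {0} < ⊤ := (isCompact_singleton).measure_lt_top
  refine (h2.union (integrableOn_singleton (hx := h3))).mono_set fun x hx => ?_
  have hx' : 0 ≤ Real.log ‖x‖ := hx
  rcases (norm_nonneg x).eq_or_lt with h0 | h0
  · exact Or.inr (norm_eq_zero.1 h0.symm)
  · exact Or.inl ((Real.log_nonneg_iff h0).1 hx')

lemma logMeasure_ne_zero (hV : AEMeasurable V) {C R₁ R₂ : ℝ} (hC : 0 < C) (hR₁ : 0 < R₁)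
    (hR : R₁ < R₂) (hVC : ∀ᵐ x : R2, R₁ < ‖x‖ ∧ ‖x‖ < R₂ → C ≤ V x) : logMeasure V ≠ 0 := by
  rw [logMeasure, Ne, Measure.map_eq_zero_iff measurable_log_norm.aemeasurable,
    withDensity_eq_zero_iff hV.ennreal_ofReal]
  intro h
  have hnull : ∀ᵐ x : R2, x ∉ {x : R2 | R₁ < ‖x‖ ∧ ‖x‖ < R₂} := by
    filter_upwards [h, hVC] with x hx hxC hmem
    have h1 := ENNReal.ofReal_eq_zero.1 hx
    linarith [hxC hmem]
  have hopen : IsOpen {x : R2 | R₁ < ‖x‖ ∧ ‖x‖ < R₂} :=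
    (isOpen_lt continuous_const continuous_norm).inter (isOpen_lt continuous_norm continuous_const)
  have hne : {x : R2 | R₁ < ‖x‖ ∧ ‖x‖ < R₂}.Nonempty := by
    refine ⟨EuclideanSpace.single 0 ((R₁ + R₂) / 2), ?_⟩
    have : ‖(EuclideanSpace.single 0 ((R₁ + R₂) / 2) : R2)‖ = (R₁ + R₂) / 2 := by
      rw [PiLp.norm_single, Real.norm_eq_abs, abs_of_pos (by linarith)]
    simp only [Set.mem_ofPred_eq, this]
    constructor <;> linarith
  refine (hopen.measure_pos volume hne).ne' ?_
  simpa [ae_iff] using hnull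

end

/-- The radial unit vector at angle `θ`. -/
def radVec (θ : ℝ) : R2 := !₂[Real.cos θ, Real.sin θ]

/-- The angular unit vector at angle `θ`. -/
def angVec (θ : ℝ) : R2 := !₂[-Real.sin θ, Real.cos θ]

lemma HasDerivAt.vec2 {f g : ℝ → ℝ} {f' g' t : ℝ} (hf : HasDerivAt f f' t)
    (hg : HasDerivAt g g' t) : HasDerivAt (fun t => (!₂[f t, g t] : R2)) !₂[f', g'] t := by
  have h := (hf.smul_const (EuclideanSpace.single 0 1 : R2)).add
    (hg.smul_const (EuclideanSpace.single 1 1 : R2))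
  refine (h.congr_deriv ?_).congr_of_eventuallyEq (Eventually.of_forall fun s => ?_) <;>
  · ext i
    fin_cases i <;> simp

lemma hasDerivAt_radVec (θ : ℝ) : HasDerivAt radVec (angVec θ) θ :=
  (Real.hasDerivAt_cos θ).vec2 (Real.hasDerivAt_sin θ)

lemma hasDerivAt_angVec (θ : ℝ) : HasDerivAt angVec (-radVec θ) θ := by
  refine ((Real.hasDerivAt_sin θ).neg.vec2 (Real.hasDerivAt_cos θ)).congr_deriv ?_
  ext i
  fin_cases i <;> simp [radVec]

@[fun_prop]
lemma continuous_radVec : Continuous radVec :=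
  continuous_iff_continuousAt.2 fun θ => (hasDerivAt_radVec θ).continuousAt

@[fun_prop]
lemma continuous_angVec : Continuous angVec :=
  continuous_iff_continuousAt.2 fun θ => (hasDerivAt_angVec θ).continuousAt

lemma norm_radVec (θ : ℝ) : ‖radVec θ‖ = 1 := by
  have h : ‖radVec θ‖ ^ 2 = 1 ^ 2 := by
    rw [EuclideanSpace.norm_sq_eq]
    simp [radVec]
  exact (sq_eq_sq₀ (norm_nonneg _) zero_le_one).1 h

/-- Rotation by the angle `θ`. -/
def rot (θ : ℝ) : R2 ≃ₗᵢ[ℝ] R2 :=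
  LinearIsometry.toLinearIsometryEquiv
    { toFun := fun x => x 0 • radVec θ + x 1 • angVec θ
      map_add' := fun x y => by simp only [PiLp.add_apply]; module
      map_smul' := fun c x => by simp only [PiLp.smul_apply, smul_eq_mul, RingHom.id_apply]; module
      norm_map' := fun x => by
        refine (sq_eq_sq₀ (norm_nonneg _) (norm_nonneg _)).1 ?_
        simp only [EuclideanSpace.norm_sq_eq, Fin.sum_univ_two, Real.norm_eq_abs, sq_abs]
        simp [radVec, angVec]
        linear_combination (x 0 ^ 2 + x 1 ^ 2) * Real.cos_sq_add_sin_sq θ } rfl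

lemma rot_apply (θ : ℝ) (x : R2) : rot θ x = x 0 • radVec θ + x 1 • angVec θ := rfl

lemma exists_eq_smul_radVec (x : R2) : ∃ θ, x = ‖x‖ • radVec θ := by
  have hn : ‖x‖ = ‖(⟨x 0, x 1⟩ : ℂ)‖ := by
    refine (sq_eq_sq₀ (norm_nonneg _) (norm_nonneg _)).1 ?_
    rw [EuclideanSpace.norm_sq_eq, Complex.sq_norm, Complex.normSq_apply]
    simp [sq]
  refine ⟨(⟨x 0, x 1⟩ : ℂ).arg, ?_⟩
  ext i
  fin_cases i
  · simp [radVec, hn]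
  · simp [radVec, hn]

lemma rot_smul_radVec (r θ θ' : ℝ) : rot θ (r • radVec θ') = r • radVec (θ + θ') := by
  rw [rot_apply]
  ext i
  fin_cases i
  · simp [radVec, angVec, Real.cos_add]; ring
  · simp [radVec, angVec, Real.sin_add]; ring

lemma periodic_radVec : Function.Periodic radVec (2 * π) := fun θ => by simp [radVec]

lemma periodic_angVec : Function.Periodic angVec (2 * π) := fun θ => by simp [angVec]

/-- Mean of `φ` over the circle of radius `r`. -/
def circleMean (φ : R2 → ℝ) (r : ℝ) : ℝ := (2 * π)⁻¹ * ∫ θ in -π..π, φ (r • radVec θ)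

lemma integral_rot (φ : R2 → ℝ) (x : R2) :
    ∫ θ in -π..π, φ (rot θ x) = ∫ θ in -π..π, φ (‖x‖ • radVec θ) := by
  obtain ⟨θ', hθ'⟩ := exists_eq_smul_radVec x
  have h1 : ∀ θ, φ (rot θ x) = φ (‖x‖ • radVec (θ + θ')) := fun θ => by
    rw [← rot_smul_radVec, ← hθ']
  simp only [h1]
  rw [intervalIntegral.integral_comp_add_right (fun θ => φ (‖x‖ • radVec θ))]
  have hper : Function.Periodic (fun θ => φ (‖x‖ • radVec θ)) (2 * π) := fun θ => by
    simp only [periodic_radVec θ]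
  have := hper.intervalIntegral_add_eq (-π + θ') (-π)
  rwa [show -π + θ' + 2 * π = π + θ' by ring, show -π + 2 * π = π by ring] at this

lemma integral_mul_circleMean {G : R2 → ℝ} (hG : LocallyIntegrable G) (hrad : RadSym G)
    {φ : R2 → ℝ} (hφ : Continuous φ) (hc : HasCompactSupport φ) :
    ∫ x, G x * φ x = ∫ x, G x * circleMean φ ‖x‖ := by
  obtain ⟨L, -, hL⟩ := hc.exists_pos_le_norm
  obtain ⟨M, hM⟩ := hc.exists_bound_of_continuous hφ
  have hinv : ∀ θ, ∫ x, G x * φ (rot θ x) = ∫ x, G x * φ x := fun θ => by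
    rw [← (rot θ).measurePreserving.integral_comp (rot θ).toHomeomorph.measurableEmbedding
      (fun x => G x * φ x)]
    congr 1; ext x
    rw [hrad (rot θ x) x ((rot θ).norm_map x)]
  have : IsFiniteMeasure (volume.restrict (Set.uIoc (-π) π)) :=
    isFiniteMeasure_restrict_Ioc _ _
  have hint : Integrable (Function.uncurry fun θ x => G x * φ (rot θ x))
      ((volume.restrict (Set.uIoc (-π) π)).prod volume) := by
    have h1 : Integrable (fun p : ℝ × R2 => φ (rot p.1 p.2) *
        ((1 : ℝ) * (closedBall 0 L).indicator G p.2))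
        ((volume.restrict (Set.uIoc (-π) π)).prod volume) := by
      refine Integrable.bdd_mul (c := M) (Integrable.mul_prod (f := fun _ => (1 : ℝ))
        (integrable_const 1) ((hG.integrableOn_isCompact
          (isCompact_closedBall 0 L)).integrable_indicator measurableSet_closedBall)) ?_
        (Eventually.of_forall fun p => hM _)
      refine Continuous.aestronglyMeasurable ?_
      simp only [rot_apply]
      fun_prop
    refine h1.congr (Eventually.of_forall fun p => ?_)
    simp only [Function.uncurry]
    by_cases hp : p.2 ∈ closedBall 0 L
    · rw [Set.indicator_of_mem hp]; ring
    · rw [Set.indicator_of_notMem hp, hL (rot p.1 p.2), mul_zero, mul_zero, mul_zero]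
      rw [(rot p.1).norm_map]
      rw [mem_closedBall_zero_iff, not_le] at hp
      exact hp.le
  have hswap := intervalIntegral_integral_swap hint
  simp only [hinv, intervalIntegral.integral_const, intervalIntegral.integral_const_mul,
    integral_rot, smul_eq_mul] at hswap
  have hπ : (2 * π) ≠ 0 := by positivity
  calc ∫ x, G x * φ x = (2 * π)⁻¹ * ((π - -π) * ∫ x, G x * φ x) := by
        rw [sub_neg_eq_add, ← two_mul, inv_mul_cancel_left₀ hπ]
    _ = (2 * π)⁻¹ * ∫ x, G x * ∫ θ in -π..π, φ (‖x‖ • radVec θ) := by rw [hswap]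
    _ = _ := by
        rw [← integral_const_mul]
        congr 1; ext x
        rw [circleMean]; ring

lemma hasDerivAt_intervalIntegral_of_bounded {F F' : ℝ → ℝ → ℝ} (hF : ∀ r, Continuous (F r))
    (hF' : ∀ r, Continuous (F' r)) {M : ℝ} (hM : ∀ r θ, |F' r θ| ≤ M)
    (hd : ∀ r θ, HasDerivAt (fun r => F r θ) (F' r θ) r) (a c r : ℝ) :
    HasDerivAt (fun r => ∫ θ in a..c, F r θ) (∫ θ in a..c, F' r θ) r :=
  (intervalIntegral.hasDerivAt_integral_of_dominated_loc_of_deriv_le (bound := fun _ => M)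
    Filter.univ_mem (Eventually.of_forall fun r => (hF r).aestronglyMeasurable)
    ((hF r).intervalIntegrable _ _) (hF' r).aestronglyMeasurable
    (Eventually.of_forall fun θ _ r _ => hM r θ) intervalIntegrable_const
    (Eventually.of_forall fun θ _ r _ => hd r θ)).2

section

variable {φ : R2 → ℝ}

lemma lap_eq (φ : R2 → ℝ) (x : R2) (θ : ℝ) :
    lap φ x = fderiv ℝ (fderiv ℝ φ) x (radVec θ) (radVec θ) +
      fderiv ℝ (fderiv ℝ φ) x (angVec θ) (angVec θ) := by
  have h1 : radVec θ = Real.cos θ • EuclideanSpace.single 0 1 +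
      Real.sin θ • EuclideanSpace.single 1 1 := by
    ext i
    fin_cases i <;> simp [radVec]
  have h2 : angVec θ = (-Real.sin θ) • EuclideanSpace.single 0 1 +
      Real.cos θ • EuclideanSpace.single 1 1 := by
    ext i
    fin_cases i <;> simp [angVec]
  simp only [lap, iteratedFDeriv_two_apply, Fin.sum_univ_two, h1, h2, map_add, map_smul,
    add_apply, smul_apply, smul_eq_mul, Matrix.cons_val_zero, Matrix.cons_val_one]
  linear_combination (-(fderiv ℝ (fderiv ℝ φ) x (EuclideanSpace.single 0 1)
      (EuclideanSpace.single 0 1)) - fderiv ℝ (fderiv ℝ φ) x (EuclideanSpace.single 1 1)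
      (EuclideanSpace.single 1 1)) * Real.cos_sq_add_sin_sq θ

lemma contDiff_fderiv_of_smooth (hφ : ContDiff ℝ (⊤ : ℕ∞) φ) :
    ContDiff ℝ (⊤ : ℕ∞) (fderiv ℝ φ) :=
  hφ.fderiv_right (by simp)

lemma contDiff_fderiv_fderiv_of_smooth (hφ : ContDiff ℝ (⊤ : ℕ∞) φ) :
    ContDiff ℝ (⊤ : ℕ∞) (fderiv ℝ (fderiv ℝ φ)) :=
  (contDiff_fderiv_of_smooth hφ).fderiv_right (by simp)

lemma continuous_lap (hφ : ContDiff ℝ (⊤ : ℕ∞) φ) : Continuous (lap φ) := by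
  have h := (contDiff_fderiv_fderiv_of_smooth hφ).continuous
  rw [funext fun x => lap_eq φ x 0]
  fun_prop

lemma hasCompactSupport_lap (hc : HasCompactSupport φ) : HasCompactSupport (lap φ) := by
  rw [funext fun x => lap_eq φ x 0]
  exact ((hc.fderiv ℝ).fderiv ℝ).comp_left
    (g := fun B : R2 →L[ℝ] R2 →L[ℝ] ℝ => B (radVec 0) (radVec 0) + B (angVec 0) (angVec 0))
    (by simp)

/-- Mean over the circle of radius `r` of the radial derivative. -/
def circleMeanDeriv (φ : R2 → ℝ) (r : ℝ) : ℝ :=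
  (2 * π)⁻¹ * ∫ θ in -π..π, fderiv ℝ φ (r • radVec θ) (radVec θ)

/-- Mean over the circle of radius `r` of the second radial derivative. -/
def circleMeanDeriv2 (φ : R2 → ℝ) (r : ℝ) : ℝ :=
  (2 * π)⁻¹ * ∫ θ in -π..π, fderiv ℝ (fderiv ℝ φ) (r • radVec θ) (radVec θ) (radVec θ)

lemma hasDerivAt_smul_radVec (r θ : ℝ) : HasDerivAt (fun r : ℝ => r • radVec θ) (radVec θ) r := by
  simpa using (hasDerivAt_id r).smul_const (radVec θ)

lemma hasDerivAt_circleMean (hφ : ContDiff ℝ (⊤ : ℕ∞) φ) (hc : HasCompactSupport φ) (r : ℝ) :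
    HasDerivAt (circleMean φ) (circleMeanDeriv φ r) r := by
  have h0 := hφ.continuous
  have h1 := (contDiff_fderiv_of_smooth hφ).continuous
  obtain ⟨M, hM⟩ := (hc.fderiv ℝ).exists_bound_of_continuous h1
  refine HasDerivAt.const_mul _ (hasDerivAt_intervalIntegral_of_bounded
    (F := fun r θ => φ (r • radVec θ)) (F' := fun r θ => fderiv ℝ φ (r • radVec θ) (radVec θ))
    (fun r => by fun_prop) (fun r => by fun_prop) (M := M) (fun r θ => ?_) (fun r θ => ?_) _ _ r)
  · refine ((fderiv ℝ φ (r • radVec θ)).le_opNorm (radVec θ)).trans ?_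
    rw [norm_radVec, mul_one]
    exact hM _
  · exact ((hφ.differentiable (by simp)) _).hasFDerivAt.comp_hasDerivAt r
      (hasDerivAt_smul_radVec r θ)

lemma hasDerivAt_circleMeanDeriv (hφ : ContDiff ℝ (⊤ : ℕ∞) φ) (hc : HasCompactSupport φ) (r : ℝ) :
    HasDerivAt (circleMeanDeriv φ) (circleMeanDeriv2 φ r) r := by
  have h1 := (contDiff_fderiv_of_smooth hφ).continuous
  have h2 := (contDiff_fderiv_fderiv_of_smooth hφ).continuous
  obtain ⟨L, -, hL⟩ := ((hc.fderiv ℝ).fderiv ℝ).exists_pos_le_norm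
  obtain ⟨M, hM⟩ := ((isCompact_closedBall (0 : R2) L).prod
    (isCompact_closedBall (0 : R2) 1)).exists_bound_of_continuousOn
    (f := fun p => fderiv ℝ (fderiv ℝ φ) p.1 p.2 p.2) (Continuous.continuousOn (by fun_prop))
  refine HasDerivAt.const_mul _ (hasDerivAt_intervalIntegral_of_bounded
    (F := fun r θ => fderiv ℝ φ (r • radVec θ) (radVec θ))
    (F' := fun r θ => fderiv ℝ (fderiv ℝ φ) (r • radVec θ) (radVec θ) (radVec θ))
    (fun r => by fun_prop) (fun r => by fun_prop) (M := max M 0) (fun r θ => ?_) (fun r θ => ?_) _ _ r)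
  · by_cases hx : ‖r • radVec θ‖ ≤ L
    · exact (hM (r • radVec θ, radVec θ) ⟨mem_closedBall_zero_iff.2 hx,
        mem_closedBall_zero_iff.2 (norm_radVec θ).le⟩).trans (le_max_left _ _)
    · rw [hL _ (not_le.1 hx).le]
      simp
  · have h3 := (((contDiff_fderiv_of_smooth hφ).differentiable (by simp))
      (r • radVec θ)).hasFDerivAt.comp_hasDerivAt r (hasDerivAt_smul_radVec r θ)
    simpa using h3.clm_apply (hasDerivAt_const r (radVec θ))

lemma continuous_circleMeanDeriv2 (hφ : ContDiff ℝ (⊤ : ℕ∞) φ) :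
    Continuous (circleMeanDeriv2 φ) := by
  have h2 := (contDiff_fderiv_fderiv_of_smooth hφ).continuous
  refine continuous_const.mul
    (intervalIntegral.continuous_parametric_intervalIntegral_of_continuous' ?_ _ _)
  simp only [Function.uncurry_def]
  fun_prop

/-- The Laplacian commutes with taking circle means. -/
lemma mul_circleMean_lap (hφ : ContDiff ℝ (⊤ : ℕ∞) φ) (r : ℝ) :
    r * circleMean (lap φ) r = circleMeanDeriv φ r + r * circleMeanDeriv2 φ r := by
  have h1 := (contDiff_fderiv_of_smooth hφ).continuous
  have h2 := (contDiff_fderiv_fderiv_of_smooth hφ).continuous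
  have hder : ∀ θ, HasDerivAt (fun θ => fderiv ℝ φ (r • radVec θ) (angVec θ))
      (r * fderiv ℝ (fderiv ℝ φ) (r • radVec θ) (angVec θ) (angVec θ) -
        fderiv ℝ φ (r • radVec θ) (radVec θ)) θ := fun θ => by
    have h3 := (((contDiff_fderiv_of_smooth hφ).differentiable (by simp))
      (r • radVec θ)).hasFDerivAt.comp_hasDerivAt θ ((hasDerivAt_radVec θ).const_smul r)
    have h4 := h3.clm_apply (hasDerivAt_angVec θ)
    refine h4.congr_deriv ?_
    simp [sub_eq_add_neg]
  have hzero : ∫ θ in -π..π, (r * fderiv ℝ (fderiv ℝ φ) (r • radVec θ) (angVec θ) (angVec θ) -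
      fderiv ℝ φ (r • radVec θ) (radVec θ)) = 0 := by
    rw [intervalIntegral.integral_eq_sub_of_hasDerivAt (fun θ _ => hder θ)
      (Continuous.intervalIntegrable (by fun_prop) _ _)]
    have e1 := periodic_radVec (-π)
    have e2 := periodic_angVec (-π)
    rw [show -π + 2 * π = π by ring] at e1 e2
    rw [e1, e2, sub_self]
  have hA : IntervalIntegrable (fun θ => fderiv ℝ (fderiv ℝ φ) (r • radVec θ) (angVec θ)
      (angVec θ)) volume (-π) π := Continuous.intervalIntegrable (by fun_prop) _ _
  have hB : IntervalIntegrable (fun θ => fderiv ℝ (fderiv ℝ φ) (r • radVec θ) (radVec θ)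
      (radVec θ)) volume (-π) π := Continuous.intervalIntegrable (by fun_prop) _ _
  have hD : IntervalIntegrable (fun θ => fderiv ℝ φ (r • radVec θ) (radVec θ)) volume (-π) π :=
    Continuous.intervalIntegrable (by fun_prop) _ _
  rw [intervalIntegral.integral_sub (hA.const_mul r) hD, intervalIntegral.integral_const_mul,
    sub_eq_zero] at hzero
  rw [circleMean, circleMeanDeriv, circleMeanDeriv2, ← hzero,
    intervalIntegral.integral_congr (fun θ _ => lap_eq φ (r • radVec θ) θ),
    intervalIntegral.integral_add hB hA]
  ring

lemma exists_forall_circleMean_eq_zero (hc : HasCompactSupport φ) :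
    ∃ L, 0 ≤ L ∧ (∀ r, L ≤ r → circleMean φ r = 0) ∧ (∀ r, L ≤ r → circleMeanDeriv φ r = 0) ∧
      ∀ r, L ≤ r → circleMeanDeriv2 φ r = 0 := by
  obtain ⟨L₀, hL₀, h0⟩ := hc.exists_pos_le_norm
  obtain ⟨L₁, -, h1⟩ := (hc.fderiv ℝ).exists_pos_le_norm
  obtain ⟨L₂, -, h2⟩ := ((hc.fderiv ℝ).fderiv ℝ).exists_pos_le_norm
  have hnorm : ∀ r θ : ℝ, max L₀ (max L₁ L₂) ≤ r → ‖r • radVec θ‖ = r := fun r θ hr => by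
    rw [norm_smul, norm_radVec, mul_one, Real.norm_eq_abs,
      abs_of_nonneg (hL₀.le.trans ((le_max_left _ _).trans hr))]
  refine ⟨max L₀ (max L₁ L₂), hL₀.le.trans (le_max_left _ _), fun r hr => ?_, fun r hr => ?_,
    fun r hr => ?_⟩
  · have : ∀ θ, φ (r • radVec θ) = 0 := fun θ => h0 _ (by
      rw [hnorm r θ hr]; exact (le_max_left _ _).trans hr)
    simp [circleMean, this]
  · have : ∀ θ, fderiv ℝ φ (r • radVec θ) = 0 := fun θ => h1 _ (by
      rw [hnorm r θ hr]; exact (le_max_left _ _).trans ((le_max_right _ _).trans hr))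
    simp [circleMeanDeriv, this]
  · have : ∀ θ, fderiv ℝ (fderiv ℝ φ) (r • radVec θ) = 0 := fun θ => h2 _ (by
      rw [hnorm r θ hr]; exact (le_max_right _ _).trans ((le_max_right _ _).trans hr))
    simp [circleMeanDeriv2, this]

end

namespace IsLogSol

variable {b : ℝ} {ν : Measure ℝ} {V : R2 → ℝ} {u : ℝ → ℝ}

lemma locallyIntegrable_comp_log_norm (h : IsLogSol b ν u) (hb : 0 ≤ b) :
    LocallyIntegrable fun x : R2 => u (Real.log ‖x‖) := by
  intro x
  refine ⟨ball 0 (‖x‖ + 1), isOpen_ball.mem_nhds (by simp), ?_⟩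
  rw [integrableOn_fun_norm_addHaar volume (f := fun r => u (Real.log r))]
  have h1 := ((h.integrableOn_comp_log hb (by positivity : 0 ≤ ‖x‖ + 1)).mul_continuousOn
    continuousOn_id isCompact_Icc).mono_set Set.Ioo_subset_Icc_self
  refine h1.congr_fun (fun r _ => ?_) measurableSet_Ioo
  simp [mul_comm]

lemma hasFDerivAt_comp_log_norm [NullSingletonClass ν] (h : IsLogSol b ν u) {x : R2} (hx : x ≠ 0) :
    HasFDerivAt (fun x : R2 => u (Real.log ‖x‖))
      ((b * leftMass ν u (Real.log ‖x‖) * ‖x‖⁻¹) • fderiv ℝ (fun x : R2 => ‖x‖) x) x := by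
  have h1 : HasDerivAt (fun r => u (Real.log r)) (b * leftMass ν u (Real.log ‖x‖) * ‖x‖⁻¹) ‖x‖ :=
    (h.hasDerivAt (Real.log ‖x‖)).comp ‖x‖ (Real.hasDerivAt_log (norm_ne_zero_iff.2 hx))
  exact h1.comp_hasFDerivAt x ((contDiffAt_norm ℝ hx (n := 1)).differentiableAt (by simp)).hasFDerivAt

lemma contDiffOn_comp_log_norm [NullSingletonClass ν] (h : IsLogSol b ν u) :
    ContDiffOn ℝ 1 (fun x : R2 => u (Real.log ‖x‖)) {0}ᶜ := fun x hx =>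
  ((h.contDiff.contDiffAt).comp x ((contDiffAt_norm ℝ hx).log
    (norm_ne_zero_iff.2 hx))).contDiffWithinAt

lemma norm_gradient_comp_log_norm_le [NullSingletonClass ν] (h : IsLogSol b ν u) (hb : 0 ≤ b)
    {x : R2} (hx : x ≠ 0) : ‖gradient (fun x : R2 => u (Real.log ‖x‖)) x‖ ≤
      b * leftMass ν u (Real.log ‖x‖) * ‖x‖⁻¹ := by
  have hm := leftMass_nonneg (ν := ν) (u := u) (Real.log ‖x‖)
  rw [gradient, LinearIsometryEquiv.norm_map, (h.hasFDerivAt_comp_log_norm hx).fderiv, norm_smul,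
    Real.norm_eq_abs, abs_of_nonneg (by positivity)]
  refine mul_le_of_le_one_right (by positivity) ?_
  simpa using norm_fderiv_le_of_lipschitz ℝ (x₀ := x) (lipschitzWith_one_norm (E := R2))

lemma integrableOn_norm_gradient_sq [NullSingletonClass ν] (h : IsLogSol b ν u) (hb : 0 < b)
    (hfin : ∀ R, ν (Set.Iic R) < ⊤) {R : ℝ} (hR : 0 < R) :
    IntegrableOn (fun x : R2 => ‖gradient (fun x : R2 => u (Real.log ‖x‖)) x‖ ^ 2)
      (ball 0 R \ {0}) := by
  have h1 : IntegrableOn (fun x : R2 => (b * leftMass ν u (Real.log ‖x‖) * ‖x‖⁻¹) ^ 2)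
      (ball 0 R) := by
    rw [integrableOn_fun_norm_addHaar volume (f := fun r => (b * leftMass ν u (Real.log r) * r⁻¹) ^ 2)]
    refine IntegrableOn.congr_fun ((h.integrableOn_leftMass_sq hb hfin hR).const_mul (b ^ 2))
      (fun r hr => ?_) measurableSet_Ioo
    have hr0 : r ≠ 0 := hr.1.ne'
    simp only [finrank_euclideanSpace, Fintype.card_fin, smul_eq_mul]
    norm_num
    field_simp
  refine (h1.mono_set Set.sdiff_subset).mono' ?_ ?_
  · have hg : (fun x : R2 => ‖gradient (fun x : R2 => u (Real.log ‖x‖)) x‖ ^ 2) =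
        fun x => ‖fderiv ℝ (fun x : R2 => u (Real.log ‖x‖)) x‖ ^ 2 := by
      ext x
      rw [gradient, LinearIsometryEquiv.norm_map]
    rw [hg]
    exact ((measurable_fderiv ℝ _).norm.pow_const 2).aestronglyMeasurable
  · refine (ae_restrict_iff' (measurableSet_ball.diff (measurableSet_singleton 0))).2
      (Eventually.of_forall fun x hx => ?_)
    rw [norm_pow, norm_norm]
    gcongr
    exact h.norm_gradient_comp_log_norm_le hb.le hx.2

lemma integrable_mul_exp_comp_log_norm (h : IsLogSol b (logMeasure V) u) (hV : AEMeasurable V)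
    (hV0 : ∀ x, 0 ≤ V x) : Integrable fun x : R2 => V x * Real.exp (u (Real.log ‖x‖)) := by
  have hu := h.continuous.measurable
  exact (integrable_logMeasure_iff hV hV0 (by fun_prop)).1 h.integrable

lemma integral_mul_exp_comp_log_norm (h : IsLogSol b (logMeasure V) u) (hV : AEMeasurable V)
    (hV0 : ∀ x, 0 ≤ V x) : ∫ x : R2, V x * Real.exp (u (Real.log ‖x‖)) = 1 := by
  have hu := h.continuous.measurable
  rw [← integral_logMeasure hV hV0 (F := fun s => Real.exp (u s)) (by fun_prop), h.integral_eq]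

/-- The radial function `u (log ‖x‖)` solves the Liouville equation weakly. -/
lemma integral_comp_log_norm_mul_lap (h : IsLogSol b (logMeasure V) u) (hb : 0 ≤ b)
    (hV : AEMeasurable V) (hV0 : ∀ x, 0 ≤ V x) (hVrad : RadSym V)
    {φ : R2 → ℝ} (hφ : ContDiff ℝ (⊤ : ℕ∞) φ) (hc : HasCompactSupport φ) :
    ∫ x, u (Real.log ‖x‖) * lap φ x =
      2 * π * b * ∫ x, V x * Real.exp (u (Real.log ‖x‖)) * φ x := by
  have hu := h.continuous.measurable
  have hcm : Measurable (circleMean φ) :=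
    (continuous_iff_continuousAt.2 fun r => (hasDerivAt_circleMean hφ hc r).continuousAt).measurable
  obtain ⟨L, hL, h0, h1, h2⟩ := exists_forall_circleMean_eq_zero hc
  have hvol : (volume : Measure R2).real (ball 0 1) = π := by
    rw [Measure.real, EuclideanSpace.volume_ball_fin_two]
    simp [Real.pi_nonneg]
  calc ∫ x, u (Real.log ‖x‖) * lap φ x
      = ∫ x : R2, u (Real.log ‖x‖) * circleMean (lap φ) ‖x‖ :=
        integral_mul_circleMean (h.locallyIntegrable_comp_log_norm hb)
          (fun x y hxy => by simp only [hxy]) (continuous_lap hφ) (hasCompactSupport_lap hc)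
    _ = 2 * π * ∫ r in Set.Ioi 0, u (Real.log r) * (circleMeanDeriv φ r + r * circleMeanDeriv2 φ r) := by
        rw [integral_fun_norm_addHaar volume
          (fun r => u (Real.log r) * circleMean (lap φ) r), hvol]
        simp only [finrank_euclideanSpace, Fintype.card_fin, smul_eq_mul, nsmul_eq_mul,
          ← mul_circleMean_lap hφ]
        norm_num
        rw [mul_assoc]
        congr 3; ext r; ring
    _ = 2 * π * (b * ∫ s, circleMean φ (Real.exp s) * Real.exp (u s) ∂(logMeasure V)) := by
        rw [h.integral_comp_log_mul hb (hasDerivAt_circleMean hφ hc)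
          (hasDerivAt_circleMeanDeriv hφ hc) (continuous_circleMeanDeriv2 hφ) hL h0 h1 h2]
    _ = 2 * π * (b * ∫ x : R2, V x * Real.exp (u (Real.log ‖x‖)) * circleMean φ ‖x‖) := by
        rw [integral_logMeasure hV hV0 (F := fun s => circleMean φ (Real.exp s) * Real.exp (u s))
          (by fun_prop)]
        congr 2
        refine integral_congr_ae ?_
        filter_upwards [Measure.ae_ne volume (0 : R2)] with x hx
        rw [Real.exp_log (norm_pos_iff.2 hx)]
        ring
    _ = 2 * π * b * ∫ x, V x * Real.exp (u (Real.log ‖x‖)) * φ x := by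
        rw [integral_mul_circleMean (h.integrable_mul_exp_comp_log_norm hV hV0).locallyIntegrable
          (fun x y hxy => by simp only [hxy, hVrad x y hxy]) hφ.continuous hc]
        ring

end IsLogSol

/-- Theorem 1.1, part (2): existence of a radially symmetric solution to the
Liouville equation for -α(V) ≤ β < 0 and nonnegative radially symmetric V. -/
theorem existence_beta_neg_radial (β : ℝ) (hβ : β < 0) (V : R2 → ℝ)
    (hV0 : ∀ x, 0 ≤ V x) (hVloc : LocallyIntegrable V) (hVrad : RadSym V)
    (C R₁ R₂ : ℝ) (hC : 0 < C) (hR₁ : 0 < R₁) (hR : R₁ < R₂)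
    (hVC : ∀ᵐ x : R2, R₁ < ‖x‖ ∧ ‖x‖ < R₂ → C ≤ V x)
    (hint : ∀ α : ℝ, α < -β →
      IntegrableOn (fun x : R2 => V x * ‖x‖ ^ (2*α)) {x : R2 | 1 ≤ ‖x‖}) :
    ∃ ψ : R2 → ℝ, LocallyIntegrable ψ ∧ RadSym ψ ∧ ContDiffOn ℝ 1 ψ {(0:R2)}ᶜ ∧
      (∀ R : ℝ, 0 < R →
        IntegrableOn (fun x : R2 => ‖gradient ψ x‖ ^ 2) (ball (0:R2) R \ {0})) ∧
      IsWeakSol ψ (fun x => 4 * π * β * V x * Real.exp (ψ x)) ∧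
      (∫ x : R2, V x * Real.exp (ψ x)) = 1 ∧
      Tendsto (fun x : R2 => ψ x / Real.log ‖x‖) (cobounded R2) (nhds (-(2*β))) := by
  have hV := hVloc.aestronglyMeasurable.aemeasurable
  have hb : 0 < 2 * -β := by linarith
  have hfin := logMeasure_Iic_lt_top hVloc
  obtain ⟨u, hu⟩ := exists_log_radial_solution hb hfin
    (fun a ha => integrableOn_exp_logMeasure hVloc hV0 hint ha)
    (logMeasure_ne_zero hV hC hR₁ hR hVC)
  refine ⟨fun x => u (Real.log ‖x‖), hu.locallyIntegrable_comp_log_norm hb.le,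
    fun x y hxy => by simp only [hxy], hu.contDiffOn_comp_log_norm,
    fun R hR => hu.integrableOn_norm_gradient_sq hb hfin hR, fun φ hφ hc => ?_,
    hu.integral_mul_exp_comp_log_norm hV hV0, ?_⟩
  · rw [hu.integral_comp_log_norm_mul_lap hb.le hV hV0 hVrad hφ hc, ← integral_neg,
      ← integral_const_mul]
    congr 1; ext x; ring
  · rw [← mul_neg]
    exact hu.tendsto_div.comp (Real.tendsto_log_atTop.comp tendsto_norm_cobounded_atTop)
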